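/- arXiv:1310.1789 — 2 statements merged into one kernel-verified Lean document; each statement's English description precedes it below -/
import Mathlib

section
/- For every family of graph-directed self-similar measures (μ_i)_{i∈V} and every q ≥ 0, the lower and upper L^q-spectra of each μ_i coincide (so the L^q-spectrum τ_{μ_i}(q) exists), and moreover τ_{μ_i}(q) = τ_{μ_j}(q) for all vertices i, j ∈ V. -/
open MeasureTheory Filter Set

noncomputable section

/-- The lower `L^q`-spectrum of a measure. -/
def lowerLq {X : Type*} [MeasurableSpace X] [PseudoMetricSpace X] (ν : Measure X) (q : ℝ) : ℝ :=
  liminf (fun δ : ℝ =>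
      Real.log (∫ x, (ν (Metric.ball x δ)).toReal ^ (q - 1) ∂ν) / (-Real.log δ))
    (nhdsWithin 0 (Set.Ioi 0))

/-- The upper `L^q`-spectrum of a measure. -/
def upperLq {X : Type*} [MeasurableSpace X] [PseudoMetricSpace X] (ν : Measure X) (q : ℝ) : ℝ :=
  limsup (fun δ : ℝ =>
      Real.log (∫ x, (ν (Metric.ball x δ)).toReal ^ (q - 1) ∂ν) / (-Real.log δ))
    (nhdsWithin 0 (Set.Ioi 0))

section helpers
open scoped ENNReal Topology

lemma fekete_iter (a E : ℝ → ℝ) (hs : ∀ t s, 0 ≤ t → 0 ≤ s → a t + a s - E t ≤ a (t + s))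
    (t s : ℝ) (ht : 0 ≤ t) (hs0 : 0 ≤ s) (n : ℕ) :
    n * (a t - E t) + a s ≤ a (n * t + s) := by
  induction n with
  | zero => simp
  | succ n ih =>
    have h := hs t (n * t + s) ht (by positivity)
    have : ((n + 1 : ℕ) : ℝ) * t + s = t + (n * t + s) := by push_cast; ring
    rw [this]; push_cast; linarith

lemma fekete (a E : ℝ → ℝ) (A : ℝ) (hb : ∀ t, 0 ≤ t → |a t| ≤ A * (1 + t))
    (hs : ∀ t s, 0 ≤ t → 0 ≤ s → a t + a s - E t ≤ a (t + s))
    (hE : Tendsto (fun t => E t / t) atTop (𝓝 0)) :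
    ∃ L, Tendsto (fun t => a t / t) atTop (𝓝 L) := by
  have hA : 0 ≤ A := by have := (abs_nonneg _).trans (hb 0 le_rfl); linarith
  have hbd : ∀ᶠ t in atTop, |a t / t| ≤ 2 * A := by
    filter_upwards [eventually_ge_atTop (1 : ℝ)] with t ht
    rw [abs_div, abs_of_pos (by linarith : (0:ℝ) < t), div_le_iff₀ (by linarith)]
    have := hb t (by linarith)
    nlinarith
  have hbu : IsBoundedUnder (· ≤ ·) atTop (fun t => a t / t) :=
    ⟨2 * A, by simpa using hbd.mono fun t h => (abs_le.1 h).2⟩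
  have hbl : IsBoundedUnder (· ≥ ·) atTop (fun t => a t / t) :=
    ⟨-(2 * A), by simpa using hbd.mono fun t h => (abs_le.1 h).1⟩
  refine ⟨limsup (fun t => a t / t) atTop, tendsto_order.2 ⟨fun l hl => ?_, fun u hu =>
    eventually_lt_of_limsup_lt hu hbu⟩⟩
  set L := limsup (fun t => a t / t) atTop
  set ε := (L - l) / 2 with hε
  have hεp : 0 < ε := by simp only [hε]; linarith
  have h1 : ∃ᶠ t in atTop, L - ε < a t / t :=
    frequently_lt_of_lt_limsup hbl.isCoboundedUnder_le (by linarith)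
  have h2 : ∀ᶠ t in atTop, E t / t < ε := (tendsto_order.1 hE).2 _ hεp
  obtain ⟨t, h1t, h2t, h3t⟩ := (h1.and_eventually (h2.and (eventually_ge_atTop 1))).exists
  have htp : 0 < t := by linarith
  have hv : l < (a t - E t) / t := by rw [sub_div]; linarith
  have hlim : Tendsto (fun T : ℝ => (⌊t⁻¹ * T⌋₊ : ℝ) / T * (a t - E t) - A * (1 + t) / T) atTop
      (𝓝 (t⁻¹ * (a t - E t) - 0)) := by
    refine ((tendsto_nat_floor_mul_div_atTop (by positivity)).mul_const _).sub ?_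
    exact tendsto_const_nhds.div_atTop tendsto_id
  have hlt : l < t⁻¹ * (a t - E t) - 0 := by rw [sub_zero, inv_mul_eq_div]; exact hv
  filter_upwards [(tendsto_order.1 hlim).1 _ hlt, eventually_gt_atTop 0] with T hT hT0
  refine hT.trans_le ?_
  set n := ⌊t⁻¹ * T⌋₊
  have hn1 : (n : ℝ) ≤ t⁻¹ * T := Nat.floor_le (by positivity)
  have hn2 : t⁻¹ * T < n + 1 := Nat.lt_floor_add_one _
  have e : t * (t⁻¹ * T) = T := by field_simp
  have hnt1 : n * t ≤ T := by nlinarith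
  have hnt2 : T < n * t + t := by nlinarith
  have := fekete_iter a E hs t (T - n * t) htp.le (by linarith) n
  have e2 : n * t + (T - n * t) = T := by ring
  rw [e2] at this
  have h4 := (abs_le.1 (hb (T - n * t) (by linarith))).1
  have h5 : A * (1 + (T - n * t)) ≤ A * (1 + t) := by gcongr; linarith
  rw [div_mul_eq_mul_div, ← sub_div]
  gcongr
  linarith

lemma shift_lim (a : ℝ → ℝ) (L h : ℝ) (ha : Tendsto (fun t => a t / t) atTop (𝓝 L)) :
    Tendsto (fun t => a (t + h) / t) atTop (𝓝 L) := by
  have h1 : Tendsto (fun t : ℝ => t + h) atTop atTop := tendsto_atTop_add_const_right _ _ tendsto_id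
  have h2 : Tendsto (fun t : ℝ => (t + h) / t) atTop (𝓝 1) := by
    have : Tendsto (fun t : ℝ => 1 + h / t) atTop (𝓝 (1 + 0)) :=
      tendsto_const_nhds.add (tendsto_const_nhds.div_atTop tendsto_id)
    rw [add_zero] at this
    refine this.congr' ?_
    filter_upwards [eventually_gt_atTop 0] with t ht
    field_simp
  have h3 := (ha.comp h1).mul h2
  rw [mul_one] at h3
  refine h3.congr' ?_
  filter_upwards [eventually_gt_atTop 0, h1.eventually (eventually_gt_atTop 0)] with t ht ht'
  simp only [Function.comp]
  field_simp

lemma sandwich_lim (a b E : ℝ → ℝ) (L h h' : ℝ) (ha : Tendsto (fun t => a t / t) atTop (𝓝 L))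
    (hE : Tendsto (fun t => E t / t) atTop (𝓝 0))
    (h1 : ∀ᶠ t in atTop, a (t + h) - E t ≤ b t) (h2 : ∀ᶠ t in atTop, b t ≤ a (t + h') + E t) :
    Tendsto (fun t => b t / t) atTop (𝓝 L) := by
  have l1 := (shift_lim a L h ha).sub hE
  have l2 := (shift_lim a L h' ha).add hE
  rw [sub_zero] at l1
  rw [add_zero] at l2
  refine tendsto_of_tendsto_of_tendsto_of_le_of_le' l1 l2 ?_ ?_
  · filter_upwards [h1, eventually_gt_atTop 0] with t ht h0
    rw [← sub_div]; gcongr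
  · filter_upwards [h2, eventually_gt_atTop 0] with t ht h0
    rw [← add_div]; gcongr

lemma log_err (C D A B : ℝ) (hB : 0 < B) :
    Tendsto (fun t : ℝ => (C + D * Real.log (A + B * t)) / t) atTop (𝓝 0) := by
  have h1 : Tendsto (fun t : ℝ => A + B * t) atTop atTop :=
    tendsto_atTop_add_const_left _ _ (tendsto_id.const_mul_atTop hB)
  have h2 : Tendsto (fun t : ℝ => Real.log t / t) atTop (𝓝 0) := by
    simpa using Real.isLittleO_log_id_atTop.tendsto_div_nhds_zero
  have h3 := h2.comp h1
  have h4 : Tendsto (fun t : ℝ => (A + B * t) / t) atTop (𝓝 B) := by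
    have : Tendsto (fun t : ℝ => A / t + B) atTop (𝓝 (0 + B)) :=
      (tendsto_const_nhds.div_atTop tendsto_id).add tendsto_const_nhds
    rw [zero_add] at this
    refine this.congr' ?_
    filter_upwards [eventually_gt_atTop 0] with t ht
    field_simp
  have h5 : Tendsto (fun t : ℝ => C / t) atTop (𝓝 0) := tendsto_const_nhds.div_atTop tendsto_id
  have h6 := h5.add ((h3.mul h4).const_mul D)
  simp only [zero_mul, mul_zero, add_zero] at h6
  refine h6.congr' ?_
  filter_upwards [eventually_gt_atTop 0, h1.eventually (eventually_gt_atTop 0)] with t ht ht'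
  simp only [Function.comp]
  generalize A + B * t = y at *
  have := ht'.ne'
  field_simp

lemma rpow_anti {z : ℝ} (hz : z ≤ 0) {a b : ℝ≥0∞} (h : a ≤ b) : b ^ z ≤ a ^ z := by
  have hz' : 0 ≤ -z := by linarith
  have := ENNReal.inv_le_inv.2 (ENNReal.rpow_le_rpow h hz')
  rwa [← ENNReal.rpow_neg, ← ENNReal.rpow_neg, neg_neg] at this

/-- The function `a ↦ a * a^(q-1)`, which is `a^q` with the convention `0^0 = 0`. -/
def phi (q : ℝ) (a : ℝ≥0∞) : ℝ≥0∞ := a * a ^ (q - 1)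

lemma phi_zero (q : ℝ) : phi q 0 = 0 := by simp [phi]

lemma phi_eq (q : ℝ) {a : ℝ≥0∞} (h0 : a ≠ 0) (ht : a ≠ ⊤) : phi q a = a ^ q := by
  unfold phi
  nth_rewrite 1 [← ENNReal.rpow_one a]
  rw [← ENNReal.rpow_add _ _ h0 ht]; ring_nf

lemma phi_mono {q : ℝ} (hq : 0 ≤ q) {a b : ℝ≥0∞} (hab : a ≤ b) (hb : b ≠ ⊤) :
    phi q a ≤ phi q b := by
  by_cases h0 : a = 0
  · simp [h0, phi_zero]
  have hb0 : b ≠ 0 := fun h => h0 (le_antisymm (h ▸ hab) bot_le)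
  rw [phi_eq q h0 (ne_top_of_le_ne_top hb hab), phi_eq q hb0 hb]
  exact ENNReal.rpow_le_rpow hab hq

lemma phi_mul (q : ℝ) {p : ℝ≥0∞} (hp0 : p ≠ 0) (hpt : p ≠ ⊤) {a : ℝ≥0∞} (ha : a ≠ ⊤) :
    phi q (p * a) = p ^ q * phi q a := by
  by_cases h0 : a = 0
  · simp [h0, phi_zero]
  rw [phi_eq q (mul_ne_zero hp0 h0) (ENNReal.mul_ne_top hpt ha), phi_eq q h0 ha,
    ENNReal.mul_rpow_of_ne_top hpt ha]

lemma phi_le_one {q : ℝ} (hq : 0 ≤ q) {a : ℝ≥0∞} (ha : a ≤ 1) : phi q a ≤ 1 := by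
  have := phi_mono hq ha ENNReal.one_ne_top
  simpa [phi] using this

lemma phi_sum_le {q : ℝ} (hq : 0 ≤ q) {ι : Type*} (s : Finset ι) (a : ι → ℝ≥0∞)
    (ha : ∀ i, a i ≠ ⊤) :
    phi q (∑ i ∈ s, a i) ≤ (s.card : ℝ≥0∞) ^ q * ∑ i ∈ s, phi q (a i) := by
  rcases s.eq_empty_or_nonempty with rfl | hs
  · simp [phi_zero]
  obtain ⟨m, hm, hmax⟩ := s.exists_max_image a hs
  have hc : (s.card : ℝ≥0∞) ≠ 0 := by simpa using hs.ne_empty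
  calc phi q (∑ i ∈ s, a i) ≤ phi q (s.card * a m) := by
        refine phi_mono hq ?_ (ENNReal.mul_ne_top (by simp) (ha m))
        have := Finset.sum_le_card_nsmul s a (a m) hmax
        simpa using this
    _ = (s.card : ℝ≥0∞) ^ q * phi q (a m) := phi_mul q hc (by simp) (ha m)
    _ ≤ _ := by
        gcongr
        exact Finset.single_le_sum (f := fun i => phi q (a i)) (fun _ _ => bot_le) hm

lemma phi_le_rpow (q : ℝ) {a : ℝ≥0∞} (ha : a ≠ ⊤) : phi q a ≤ a ^ q := by
  by_cases h0 : a = 0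
  · simp [h0, phi_zero]
  · rw [phi_eq q h0 ha]

lemma mean_concave {q : ℝ} (hq0 : 0 ≤ q) (hq : q ≤ 1) {ι : Type*} (s : Finset ι)
    (w a : ι → ℝ≥0∞) (hw : ∑ i ∈ s, w i = 1) :
    ∑ i ∈ s, w i * a i ^ q ≤ (∑ i ∈ s, w i * a i) ^ q := by
  rcases hq0.eq_or_lt with rfl | hq0
  · simp [hw]
  have h := ENNReal.rpow_arith_mean_le_arith_mean_rpow s w (fun i => a i ^ q) hw
    (p := q⁻¹) ((one_le_inv₀ hq0).2 hq)
  have h' := ENNReal.rpow_le_rpow h hq0.le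
  rw [← ENNReal.rpow_mul, inv_mul_cancel₀ hq0.ne', ENNReal.rpow_one] at h'
  simpa [← ENNReal.rpow_mul, mul_inv_cancel₀ hq0.ne'] using h'

lemma pow_split (q : ℝ) {T : ℝ≥0∞} (h0 : T ≠ 0) (ht : T ≠ ⊤) (x : ℝ≥0∞) :
    T ^ q * (x / T) = T ^ (q - 1) * x := by
  rw [ENNReal.rpow_sub _ _ h0 ht, ENNReal.rpow_one, div_eq_mul_inv, div_eq_mul_inv]; ring

lemma jensen_convex {q : ℝ} (hq : 1 ≤ q) {ι : Type*} (s : Finset ι) [DecidableEq ι]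
    (P a M : ι → ℝ≥0∞) (hP : ∀ i, P i ≠ ⊤) (ha : ∀ i, a i ≠ ⊤)
    (hM : ∀ i, a i ≠ 0 → ∑ j ∈ s.filter (fun j => a j ≠ 0), P j ≤ M i) :
    phi q (∑ i ∈ s, P i * a i) ≤ ∑ i ∈ s, P i * M i ^ (q - 1) * phi q (a i) := by
  classical
  set F := s.filter (fun j => a j ≠ 0) with hF
  set T := ∑ j ∈ F, P j with hT
  have hTt : T ≠ ⊤ := by simp [hT, ENNReal.sum_eq_top, hP]
  have e1 : ∑ i ∈ s, P i * a i = ∑ i ∈ F, P i * a i := by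
    rw [hF, Finset.sum_filter]; refine Finset.sum_congr rfl fun i _ => ?_
    by_cases h : a i = 0 <;> simp [h]
  have e2 : ∑ i ∈ s, P i * M i ^ (q - 1) * phi q (a i)
      = ∑ i ∈ F, P i * M i ^ (q - 1) * phi q (a i) := by
    rw [hF, Finset.sum_filter]; refine Finset.sum_congr rfl fun i _ => ?_
    by_cases h : a i = 0 <;> simp [h, phi_zero]
  rw [e1, e2]
  by_cases hT0 : T = 0
  · have : ∑ i ∈ F, P i * a i = 0 := by
      rw [hT, Finset.sum_eq_zero_iff] at hT0
      exact Finset.sum_eq_zero fun i hi => by simp [hT0 i hi]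
    rw [this, phi_zero]; exact bot_le
  have hw : ∑ i ∈ F, P i / T = 1 := by
    simp_rw [div_eq_mul_inv]; rw [← Finset.sum_mul, ← hT, ENNReal.mul_inv_cancel hT0 hTt]
  have h := ENNReal.rpow_arith_mean_le_arith_mean_rpow F (fun i => P i / T) a hw hq
  have e3 : ∑ i ∈ F, P i * a i = T * ∑ i ∈ F, P i / T * a i := by
    rw [Finset.mul_sum]; refine Finset.sum_congr rfl fun i _ => ?_
    rw [← mul_assoc, ENNReal.mul_div_cancel hT0 hTt]
  calc phi q (∑ i ∈ F, P i * a i) ≤ (∑ i ∈ F, P i * a i) ^ q := phi_le_rpow q (by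
        simp [ENNReal.sum_eq_top, ENNReal.mul_eq_top, hP, ha])
    _ = T ^ q * (∑ i ∈ F, P i / T * a i) ^ q := by
        rw [e3, ENNReal.mul_rpow_of_nonneg _ _ (by linarith)]
    _ ≤ T ^ q * ∑ i ∈ F, P i / T * a i ^ q := by gcongr
    _ = ∑ i ∈ F, P i * T ^ (q - 1) * a i ^ q := by
        rw [Finset.mul_sum]; refine Finset.sum_congr rfl fun i _ => ?_
        rw [← mul_assoc, pow_split q hT0 hTt, mul_comm (P i)]
    _ ≤ _ := by
        refine Finset.sum_le_sum fun i hi => ?_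
        have hi' : a i ≠ 0 := (Finset.mem_filter.1 hi).2
        rw [phi_eq q hi' (ha i)]
        gcongr
        exact hM i hi'

lemma jensen_concave {q : ℝ} (hq0 : 0 ≤ q) (hq : q ≤ 1) {ι : Type*} (s : Finset ι) [DecidableEq ι]
    (P a M : ι → ℝ≥0∞) (hP : ∀ i, P i ≠ ⊤) (ha : ∀ i, a i ≠ ⊤)
    (hM : ∀ i, a i ≠ 0 → ∑ j ∈ s.filter (fun j => a j ≠ 0), P j ≤ M i) :
    ∑ i ∈ s, P i * M i ^ (q - 1) * phi q (a i) ≤ phi q (∑ i ∈ s, P i * a i) := by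
  classical
  set F := s.filter (fun j => a j ≠ 0) with hF
  set T := ∑ j ∈ F, P j with hT
  have hTt : T ≠ ⊤ := by simp [hT, ENNReal.sum_eq_top, hP]
  have e1 : ∑ i ∈ s, P i * a i = ∑ i ∈ F, P i * a i := by
    rw [hF, Finset.sum_filter]; refine Finset.sum_congr rfl fun i _ => ?_
    by_cases h : a i = 0 <;> simp [h]
  have e2 : ∑ i ∈ s, P i * M i ^ (q - 1) * phi q (a i)
      = ∑ i ∈ F, P i * M i ^ (q - 1) * phi q (a i) := by
    rw [hF, Finset.sum_filter]; refine Finset.sum_congr rfl fun i _ => ?_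
    by_cases h : a i = 0 <;> simp [h, phi_zero]
  rw [e1, e2]
  by_cases hT0 : T = 0
  · rw [hT, Finset.sum_eq_zero_iff] at hT0
    rw [Finset.sum_eq_zero fun i hi => by simp [hT0 i hi]]
    exact bot_le
  have hw : ∑ i ∈ F, P i / T = 1 := by
    simp_rw [div_eq_mul_inv]; rw [← Finset.sum_mul, ← hT, ENNReal.mul_inv_cancel hT0 hTt]
  have h := mean_concave hq0 hq F (fun i => P i / T) a hw
  have e3 : ∑ i ∈ F, P i * a i = T * ∑ i ∈ F, P i / T * a i := by
    rw [Finset.mul_sum]; refine Finset.sum_congr rfl fun i _ => ?_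
    rw [← mul_assoc, ENNReal.mul_div_cancel hT0 hTt]
  have hne : ∑ i ∈ F, P i * a i ≠ 0 := by
    intro h0
    apply hT0
    rw [hT]
    rw [Finset.sum_eq_zero_iff] at h0 ⊢
    intro i hi
    exact (mul_eq_zero.1 (h0 i hi)).resolve_right (Finset.mem_filter.1 hi).2
  change phi q (∑ i ∈ F, P i * a i) ≥ _
  calc phi q (∑ i ∈ F, P i * a i) = (∑ i ∈ F, P i * a i) ^ q := phi_eq q hne (by
        simp [ENNReal.sum_eq_top, ENNReal.mul_eq_top, hP, ha])
    _ = T ^ q * (∑ i ∈ F, P i / T * a i) ^ q := by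
        rw [e3, ENNReal.mul_rpow_of_nonneg _ _ hq0]
    _ ≥ T ^ q * ∑ i ∈ F, P i / T * a i ^ q := by gcongr
    _ = ∑ i ∈ F, P i * T ^ (q - 1) * a i ^ q := by
        rw [Finset.mul_sum]; refine Finset.sum_congr rfl fun i _ => ?_
        rw [← mul_assoc, pow_split q hT0 hTt, mul_comm (P i)]
    _ ≥ _ := by
        refine Finset.sum_le_sum fun i hi => ?_
        have hi' : a i ≠ 0 := (Finset.mem_filter.1 hi).2
        rw [phi_eq q hi' (ha i)]
        exact mul_le_mul' (mul_le_mul' le_rfl (rpow_anti (by linarith) (hM i hi'))) le_rfl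

/-- Euclidean space. -/
abbrev Eu (d : ℕ) := EuclideanSpace ℝ (Fin d)

/-- The volume of the unit ball. -/
def om (d : ℕ) : ℝ≥0∞ := volume (Metric.ball (0 : Eu d) 1)

lemma om_ne_zero (d : ℕ) : om d ≠ 0 := (Metric.measure_ball_pos _ _ one_pos).ne'
lemma om_ne_top (d : ℕ) : om d ≠ ⊤ := measure_ball_lt_top.ne

lemma vol_ball {d : ℕ} (x : Eu d) {r : ℝ} (hr : 0 < r) :
    volume (Metric.ball x r) = ENNReal.ofReal r ^ d * om d := by
  rw [Measure.addHaar_ball_of_pos _ _ hr, ENNReal.ofReal_pow hr.le]; simp [om]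

/-- Lebesgue-type correlation integral. -/
def JJ {d : ℕ} (q : ℝ) (ν : Measure (Eu d)) (r : ℝ) : ℝ≥0∞ :=
  ∫⁻ x, phi q (ν (Metric.ball x r))

/-- The integral in the definition of the spectrum. -/
def II {d : ℕ} (q : ℝ) (ν : Measure (Eu d)) (r : ℝ) : ℝ≥0∞ :=
  ∫⁻ x, (ν (Metric.ball x r)) ^ (q - 1) ∂ν

lemma meas_ball {d : ℕ} (ν : Measure (Eu d)) [SFinite ν] (r : ℝ) :
    Measurable fun x => ν (Metric.ball x r) := by
  have hs : MeasurableSet {z : Eu d × Eu d | dist z.2 z.1 < r} :=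
    (isOpen_lt (by fun_prop) (by fun_prop)).measurableSet
  exact measurable_measure_prodMk_left (ν := ν) hs

lemma meas_ball_rpow {d : ℕ} (q : ℝ) (ν : Measure (Eu d)) [SFinite ν] (r : ℝ) :
    Measurable fun x => (ν (Metric.ball x r)) ^ q := (meas_ball ν r).pow_const q

lemma meas_phi {d : ℕ} (q : ℝ) (ν : Measure (Eu d)) [SFinite ν] (r : ℝ) :
    Measurable fun x => phi q (ν (Metric.ball x r)) :=
  (meas_ball ν r).mul (meas_ball_rpow _ ν r)

lemma JJ_mono {d : ℕ} {q : ℝ} (hq : 0 ≤ q) (ν : Measure (Eu d)) [IsProbabilityMeasure ν]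
    {r s : ℝ} (h : r ≤ s) : JJ q ν r ≤ JJ q ν s :=
  lintegral_mono fun _ => phi_mono hq (measure_mono (Metric.ball_subset_ball h)) (measure_ne_top _ _)

lemma simil_cont {d : ℕ} {S : Eu d → Eu d} {c : ℝ} (hc : 0 < c)
    (hS : ∀ x y, dist (S x) (S y) = c * dist x y) : Continuous S :=
  (LipschitzWith.of_dist_le_mul (K := ⟨c, hc.le⟩) fun x y => (hS x y).le).continuous

lemma lintegral_simil {d : ℕ} {S : Eu d → Eu d} {c : ℝ} (hc : 0 < c)
    (hS : ∀ x y, dist (S x) (S y) = c * dist x y) {f : Eu d → ℝ≥0∞} (hf : Measurable f) :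
    ∫⁻ x, f x = ENNReal.ofReal c ^ d * ∫⁻ x, f (S x) := by
  have hiso : Isometry (fun x => c⁻¹ • S x) := by
    refine Isometry.of_dist_eq fun x y => ?_
    rw [dist_smul₀, hS, Real.norm_eq_abs, abs_of_pos (inv_pos.2 hc)]
    field_simp
  set g := hiso.affineIsometryOfStrictConvexSpace with hg
  set L := g.linearIsometry.toLinearIsometryEquiv rfl with hL
  have hSx : ∀ x, S x = c • (L x + g 0) := by
    intro x
    have h1 : g x = c⁻¹ • S x := by simp [hg]
    have h2 : L x + g 0 = g x := by
      have := g.map_vadd 0 x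
      simp at this
      simp [hL, this]
    rw [h2, h1, smul_smul, mul_inv_cancel₀ hc.ne', one_smul]
  have h1 : ∫⁻ x, f (S x) = ∫⁻ x, f (c • (x + g 0)) := by
    simp_rw [hSx]
    exact L.measurePreserving.lintegral_comp (f := fun y => f (c • (y + g 0))) (by fun_prop)
  have h2 : ∫⁻ x, f (c • (x + g 0)) = ∫⁻ x, f (c • x) :=
    lintegral_add_right_eq_self (fun y => f (c • y)) (g 0)
  have h3 : ∫⁻ x : Eu d, f (c • x) = ENNReal.ofReal |(c ^ d)⁻¹| * ∫⁻ x, f x := by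
    have := lintegral_map (μ := (volume : Measure (Eu d))) hf (g := fun x => c • x) (by fun_prop)
    rw [← this, Measure.map_addHaar_smul _ hc.ne', lintegral_smul_measure]
    simp
  rw [h1, h2, h3, ← mul_assoc, ← ENNReal.ofReal_pow hc.le, ← ENNReal.ofReal_mul (by positivity),
    abs_of_pos (by positivity), mul_inv_cancel₀ (by positivity)]
  simp

lemma preimage_ball {d : ℕ} {S : Eu d → Eu d} {c : ℝ} (hc : 0 < c)
    (hS : ∀ x y, dist (S x) (S y) = c * dist x y) (x : Eu d) (r : ℝ) :
    S ⁻¹' (Metric.ball (S x) r) = Metric.ball x (r / c) := by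
  ext y
  simp only [mem_preimage, Metric.mem_ball, hS, lt_div_iff₀ hc, mul_comm]

lemma JJ_map {d : ℕ} {S : Eu d → Eu d} {c : ℝ} (hc : 0 < c)
    (hS : ∀ x y, dist (S x) (S y) = c * dist x y) (q : ℝ) (ν : Measure (Eu d))
    [IsProbabilityMeasure ν] (r : ℝ) :
    JJ q (ν.map S) r = ENNReal.ofReal c ^ d * JJ q ν (r / c) := by
  unfold JJ
  have hm := (simil_cont hc hS).measurable
  rw [lintegral_simil hc hS (meas_phi q _ r)]
  congr 2 with x
  rw [Measure.map_apply hm Metric.isOpen_ball.measurableSet, preimage_ball hc hS]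

lemma swap_ball {d : ℕ} (ν : Measure (Eu d)) [SFinite ν] (r : ℝ) {g : Eu d → Eu d → ℝ≥0∞}
    (hg : Measurable (Function.uncurry g)) :
    ∫⁻ x, ∫⁻ z in Metric.ball x r, g x z ∂ν = ∫⁻ z, (∫⁻ x in Metric.ball z r, g x z) ∂ν := by
  have hs : MeasurableSet {z : Eu d × Eu d | dist z.2 z.1 < r} :=
    (isOpen_lt (by fun_prop) (by fun_prop)).measurableSet
  have e1 : ∀ x, ∫⁻ z in Metric.ball x r, g x z ∂ν =
      ∫⁻ z, {z : Eu d × Eu d | dist z.2 z.1 < r}.indicator (Function.uncurry g) (x, z) ∂ν := by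
    intro x
    rw [← lintegral_indicator Metric.isOpen_ball.measurableSet]
    refine lintegral_congr fun z => ?_
    by_cases h : dist z x < r <;> simp [indicator, h, Function.uncurry]
  have e2 : ∀ z, ∫⁻ x in Metric.ball z r, g x z =
      ∫⁻ x, {z : Eu d × Eu d | dist z.2 z.1 < r}.indicator (Function.uncurry g) (x, z) := by
    intro z
    rw [← lintegral_indicator Metric.isOpen_ball.measurableSet]
    refine lintegral_congr fun x => ?_
    by_cases h : dist z x < r <;> simp [indicator, h, dist_comm x z, Function.uncurry]
  simp_rw [e1, e2]
  exact lintegral_lintegral_swap (f := fun x z => {z : Eu d × Eu d | dist z.2 z.1 < r}.indicator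
    (Function.uncurry g) (x, z)) (hg.indicator hs).aemeasurable

lemma JJ_eq {d : ℕ} (q : ℝ) (ν : Measure (Eu d)) [SFinite ν] (r : ℝ) :
    JJ q ν r = ∫⁻ z, (∫⁻ x in Metric.ball z r, ν (Metric.ball x r) ^ (q - 1)) ∂ν := by
  rw [← swap_ball ν r (g := fun x _ => ν (Metric.ball x r) ^ (q - 1))
    ((meas_ball_rpow _ ν r).comp measurable_fst)]
  unfold JJ
  refine lintegral_congr fun x => ?_
  rw [setLIntegral_const, phi, mul_comm]

lemma bsub_ball {d : ℕ} {x z : Eu d} {r s t : ℝ} (h : dist x z ≤ s) (hst : s + r ≤ t) :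
    Metric.ball x r ⊆ Metric.ball z t :=
  Metric.ball_subset_ball' (by linarith)

lemma II_le_JJ_big {d : ℕ} {q : ℝ} (hq : 1 ≤ q) (ν : Measure (Eu d)) [SFinite ν] {r : ℝ}
    (hr : 0 < r) : ENNReal.ofReal r ^ d * om d * II q ν r ≤ JJ q ν (2 * r) := by
  rw [JJ_eq, II, ← lintegral_const_mul _ (meas_ball_rpow _ ν r)]
  refine lintegral_mono fun z => ?_
  rw [← vol_ball z hr, mul_comm, ← setLIntegral_const]
  calc _ ≤ ∫⁻ x in Metric.ball z r, ν (Metric.ball x (2 * r)) ^ (q - 1) := by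
        refine setLIntegral_mono' Metric.isOpen_ball.measurableSet fun x hx => ?_
        refine ENNReal.rpow_le_rpow (measure_mono ?_) (by linarith)
        exact bsub_ball (s := r) (by rw [dist_comm]; exact (Metric.mem_ball.1 hx).le) (by linarith)
    _ ≤ _ := lintegral_mono_set (Metric.ball_subset_ball (by linarith))

lemma JJ_le_II_big {d : ℕ} {q : ℝ} (hq : 1 ≤ q) (ν : Measure (Eu d)) [SFinite ν] {r : ℝ}
    (hr : 0 < r) : JJ q ν r ≤ ENNReal.ofReal r ^ d * om d * II q ν (2 * r) := by
  rw [JJ_eq, II, ← lintegral_const_mul _ (meas_ball_rpow _ ν _)]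
  refine lintegral_mono fun z => ?_
  rw [← vol_ball z hr, mul_comm, ← setLIntegral_const]
  refine setLIntegral_mono' Metric.isOpen_ball.measurableSet fun x hx => ?_
  refine ENNReal.rpow_le_rpow (measure_mono ?_) (by linarith)
  exact bsub_ball (Metric.mem_ball.1 hx).le (by linarith)

lemma II_le_JJ_small {d : ℕ} {q : ℝ} (hq : q ≤ 1) (ν : Measure (Eu d)) [SFinite ν] {r : ℝ}
    (hr : 0 < r) : ENNReal.ofReal r ^ d * om d * II q ν (2 * r) ≤ JJ q ν r := by
  rw [JJ_eq, II, ← lintegral_const_mul _ (meas_ball_rpow _ ν _)]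
  refine lintegral_mono fun z => ?_
  rw [← vol_ball z hr, mul_comm, ← setLIntegral_const]
  refine setLIntegral_mono' Metric.isOpen_ball.measurableSet fun x hx => ?_
  refine rpow_anti (by linarith) (measure_mono ?_)
  exact bsub_ball (Metric.mem_ball.1 hx).le (by linarith)

lemma growth (u : ℕ → ℝ≥0∞) (m : ℕ) (h1 : u m ≤ 1) (hκ : 1 < 2 ^ m * u 0) :
    ∃ k < m, u (k + 1) ≤ 2 * u k := by
  by_contra! h
  have : ∀ k ≤ m, 2 ^ k * u 0 ≤ u k := by
    intro k
    induction k with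
    | zero => simp
    | succ k ih =>
      intro hk
      have h1 := ih (by omega)
      have h2 := h k (by omega)
      calc 2 ^ (k + 1) * u 0 = 2 * (2 ^ k * u 0) := by ring
        _ ≤ 2 * u k := by gcongr
        _ ≤ _ := h2.le
  exact absurd (hκ.trans_le ((this m le_rfl).trans h1)) (lt_irrefl _)

lemma JJ_le_II_small {d : ℕ} {q : ℝ} (hq0 : 0 ≤ q) (hq : q ≤ 1) (ν : Measure (Eu d))
    [IsProbabilityMeasure ν] {r : ℝ} (hr : 0 < r) (κ : ℝ≥0∞) (m : ℕ)
    (hκ : ∀ᵐ x ∂ν, κ ≤ ν (Metric.ball x r)) (hm : 1 < 2 ^ m * κ) :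
    JJ q ν r ≤ 2 * (ENNReal.ofReal ((m + 2) * r) ^ d * om d) * II q ν r := by
  set f : Eu d → ℝ≥0∞ := fun z => ν (Metric.ball z r) ^ (q - 1) with hf
  have hfm : Measurable f := meas_ball_rpow _ ν r
  have key : ∀ x, phi q (ν (Metric.ball x r)) ≤
      2 * ∫⁻ z in Metric.ball x ((m + 2) * r), f z ∂ν := by
    intro x
    by_cases h0 : ν (Metric.ball x r) = 0
    · simp [h0, phi_zero]
    obtain ⟨y, hy, hyκ⟩ : ∃ y ∈ Metric.ball x r, κ ≤ ν (Metric.ball y r) := by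
      by_contra! hcon
      apply h0
      refine measure_mono_null ?_ (ae_iff.1 hκ)
      intro y hy
      simpa using hcon y hy
    obtain ⟨k, hk, hk2⟩ := growth (fun k => ν (Metric.ball x ((k + 2) * r))) m prob_le_one (by
      refine hm.trans_le ?_
      gcongr
      refine hyκ.trans (measure_mono (bsub_ball (Metric.mem_ball.1 hy).le ?_))
      push_cast; linarith)
    set u := ν (Metric.ball x ((k + 2) * r))
    have hu : ν (Metric.ball x r) ≤ u := measure_mono (Metric.ball_subset_ball (by
      have : (0:ℝ) ≤ k := by positivity
      nlinarith))
    have hut : u ≠ ⊤ := measure_ne_top _ _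
    have hu0 : u ≠ 0 := fun h => h0 (le_antisymm (h ▸ hu) bot_le)
    calc phi q (ν (Metric.ball x r)) ≤ phi q u := phi_mono hq0 hu hut
      _ = u ^ (q - 1) * u := by rw [phi, mul_comm]
      _ ≤ 2 * (2 * u) ^ (q - 1) * u := by
          gcongr
          rw [ENNReal.mul_rpow_of_ne_top (by simp) hut, ← mul_assoc]
          have : (1 : ℝ≥0∞) ≤ 2 * 2 ^ (q - 1) := by
            have h2 := phi_eq q (a := 2) (by simp) (by simp)
            rw [phi] at h2
            rw [h2]
            calc (1 : ℝ≥0∞) = 1 ^ q := by simp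
              _ ≤ 2 ^ q := ENNReal.rpow_le_rpow (by norm_num) hq0
          calc u ^ (q - 1) = 1 * u ^ (q - 1) := by simp
            _ ≤ _ := by gcongr
      _ = 2 * ((2 * u) ^ (q - 1) * u) := by ring
      _ = 2 * ∫⁻ z in Metric.ball x ((k + 2) * r), (2 * u) ^ (q - 1) ∂ν := by
          rw [setLIntegral_const]
      _ ≤ 2 * ∫⁻ z in Metric.ball x ((k + 2) * r), f z ∂ν := by
          refine mul_le_mul' le_rfl ?_
          refine setLIntegral_mono' Metric.isOpen_ball.measurableSet fun z hz => ?_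
          refine rpow_anti (by linarith) (le_trans (measure_mono ?_) hk2)
          refine bsub_ball (Metric.mem_ball.1 hz).le ?_
          push_cast; linarith
      _ ≤ _ := by
          gcongr
  calc JJ q ν r ≤ ∫⁻ x, 2 * ∫⁻ z in Metric.ball x ((m + 2) * r), f z ∂ν := lintegral_mono key
    _ = 2 * ∫⁻ x, ∫⁻ z in Metric.ball x ((m + 2) * r), f z ∂ν := lintegral_const_mul' _ _ (by simp)
    _ = _ := by
        rw [swap_ball ν _ (g := fun _ z => f z) (hfm.comp measurable_snd)]
        simp_rw [setLIntegral_const]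
        simp_rw [fun z : Eu d => vol_ball z (show 0 < ((m:ℝ) + 2) * r by positivity)]
        rw [lintegral_mul_const _ hfm, II]
        ring

lemma JJ_doubling (d : ℕ) {q : ℝ} (hq : 0 ≤ q) (M : ℝ) : ∃ C : ℝ≥0∞, C ≠ ⊤ ∧
    ∀ (ν : Measure (Eu d)) [IsProbabilityMeasure ν] (r : ℝ), 0 < r →
      JJ q ν (M * r) ≤ C * JJ q ν r := by
  obtain ⟨t, -, ht⟩ := (isCompact_closedBall (0 : Eu d) M).elim_nhds_subcover
    (fun x => Metric.ball x 1) (fun x _ => Metric.ball_mem_nhds x one_pos)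
  refine ⟨(t.card : ℝ≥0∞) ^ q * t.card, ENNReal.mul_ne_top
    (ENNReal.rpow_ne_top_of_nonneg hq (by simp)) (by simp), fun ν _ r hr => ?_⟩
  have hcov : ∀ x : Eu d, Metric.ball x (M * r) ⊆ ⋃ v ∈ t, Metric.ball (x + r • v) r := by
    intro x y hy
    have h1 : r⁻¹ • (y - x) ∈ Metric.closedBall (0 : Eu d) M := by
      rw [mem_closedBall_zero_iff, norm_smul, norm_inv, Real.norm_eq_abs, abs_of_pos hr,
        ← dist_eq_norm, inv_mul_le_iff₀ hr, mul_comm]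
      exact (Metric.mem_ball.1 hy).le
    have h2 := ht h1
    simp only [mem_iUnion] at h2 ⊢
    obtain ⟨v, hv, hv2⟩ := h2
    refine ⟨v, hv, ?_⟩
    rw [Metric.mem_ball, dist_eq_norm] at hv2 ⊢
    have e : y - (x + r • v) = r • (r⁻¹ • (y - x) - v) := by
      rw [smul_sub, smul_smul, mul_inv_cancel₀ hr.ne', one_smul]; abel
    rw [e, norm_smul, Real.norm_eq_abs, abs_of_pos hr]
    nlinarith
  calc JJ q ν (M * r) ≤ ∫⁻ x, (t.card : ℝ≥0∞) ^ q * ∑ v ∈ t, phi q (ν (Metric.ball (x + r • v) r)) := by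
        refine lintegral_mono fun x => ?_
        refine le_trans (phi_mono hq ?_ ?_) (phi_sum_le hq t _ fun v => measure_ne_top _ _)
        · exact (measure_mono (hcov x)).trans (measure_biUnion_finset_le _ _)
        · simp [ENNReal.sum_eq_top]
    _ = (t.card : ℝ≥0∞) ^ q * ∑ v ∈ t, ∫⁻ x, phi q (ν (Metric.ball (x + r • v) r)) := by
        rw [lintegral_const_mul' _ _ (ENNReal.rpow_ne_top_of_nonneg hq (by simp)),
          lintegral_finsetSum]
        intro v _
        exact (meas_phi q ν r).comp (measurable_add_const _)
    _ = (t.card : ℝ≥0∞) ^ q * ∑ v ∈ t, JJ q ν r := by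
        congr 1
        refine Finset.sum_congr rfl fun v _ => ?_
        exact lintegral_add_right_eq_self (fun x => phi q (ν (Metric.ball x r))) (r • v)
    _ = _ := by simp [mul_assoc]

/-- Bundled data of a graph-directed system with explicit bounds. -/
structure GD {d : ℕ} {V E : Type} [Fintype E] [DecidableEq V] (src dst : E → V)
    (S : E → Eu d → Eu d) (c p : E → ℝ) (μ : V → Measure (Eu d)) (cm cM pm R : ℝ) : Prop where
  cm_pos : 0 < cm
  cM_lt : cM < 1
  cm_le : ∀ e, cm ≤ c e
  le_cM : ∀ e, c e ≤ cM
  sim : ∀ e x y, dist (S e x) (S e y) = c e * dist x y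
  pm_pos : 0 < pm
  pm_le : ∀ e, pm ≤ p e
  prob : ∀ i, IsProbabilityMeasure (μ i)
  R_pos : 0 < R
  supp : ∀ i, ∀ᵐ x ∂(μ i), x ∈ Metric.ball (0 : Eu d) R
  self : ∀ i : V, μ i = ∑ e ∈ Finset.univ.filter fun e => src e = i,
        ENNReal.ofReal (p e) • Measure.map (S e) (μ (dst e))

/-- A decomposition of `μ i` at scale `r`. -/
def Dec {d : ℕ} {V : Type} (μ : V → Measure (Eu d)) (i : V) (cm r : ℝ) : Prop :=
  ∃ (ι : Type) (_ : Fintype ι) (P : ι → ℝ≥0∞) (T : ι → Eu d → Eu d) (k : ι → ℝ) (t : ι → V),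
    (∀ w, 0 < k w) ∧ (∀ w, cm * r ≤ k w) ∧ (∀ w, k w ≤ r) ∧
    (∀ w x y, dist (T w x) (T w y) = k w * dist x y) ∧
    ∀ A, MeasurableSet A → μ i A = ∑ w, P w * μ (t w) (T w ⁻¹' A)

section
variable {d : ℕ} {V E : Type} [Fintype E] [DecidableEq V] {src dst : E → V}
    {S : E → Eu d → Eu d} {c p : E → ℝ} {μ : V → Measure (Eu d)} {cm cM pm R : ℝ}

lemma GD.c_pos (h : GD src dst S c p μ cm cM pm R) (e : E) : 0 < c e :=
  h.cm_pos.trans_le (h.cm_le e)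

lemma GD.apply (h : GD src dst S c p μ cm cM pm R) (i : V) {A : Set (Eu d)}
    (hA : MeasurableSet A) : μ i A = ∑ e ∈ Finset.univ.filter fun e => src e = i,
      ENNReal.ofReal (p e) * μ (dst e) (S e ⁻¹' A) := by
  conv_lhs => rw [h.self i]
  rw [Measure.finsetSum_apply]
  refine Finset.sum_congr rfl fun e _ => ?_
  rw [Measure.smul_apply, Measure.map_apply (simil_cont (h.c_pos e) (h.sim e)).measurable hA,
    smul_eq_mul]

lemma GD.edge_le (h : GD src dst S c p μ cm cM pm R) (e : E) {A : Set (Eu d)}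
    (hA : MeasurableSet A) :
    ENNReal.ofReal (p e) * μ (dst e) (S e ⁻¹' A) ≤ μ (src e) A := by
  rw [h.apply (src e) hA]
  exact Finset.single_le_sum (f := fun e => ENNReal.ofReal (p e) * μ (dst e) (S e ⁻¹' A))
    (fun _ _ => bot_le) (by simp)

lemma GD.one_le (h : GD src dst S c p μ cm cM pm R) (i : V) {A : Set (Eu d)}
    (hA : Metric.ball 0 R ⊆ A) : 1 ≤ μ i A := by
  have := h.prob i
  have h1 : μ i (Metric.ball 0 R) = 1 := (mem_ae_iff_prob_eq_one
    Metric.isOpen_ball.measurableSet).1 (h.supp i)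
  rw [← h1]; exact measure_mono hA

lemma GD.poly (h : GD src dst S c p μ cm cM pm R) (n : ℕ) (i : V) (r : ℝ)
    (hr : 2 * R * cM ^ n ≤ r) : ∀ᵐ x ∂(μ i), ENNReal.ofReal pm ^ n ≤ μ i (Metric.ball x r) := by
  induction n generalizing i r with
  | zero =>
    filter_upwards [h.supp i] with x hx
    rw [pow_zero]
    refine h.one_le i (bsub_ball (s := R) ?_ (by simp at hr; linarith))
    rw [dist_comm]; exact (Metric.mem_ball.1 hx).le
  | succ n ih =>
    have := h.prob
    have hm : MeasurableSet {x | ¬ ENNReal.ofReal pm ^ (n + 1) ≤ μ i (Metric.ball x r)} :=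
      (measurableSet_le measurable_const (meas_ball (μ i) r)).compl
    rw [ae_iff, h.apply i hm]
    refine Finset.sum_eq_zero fun e he => ?_
    have he' : src e = i := by simpa using he
    refine mul_eq_zero_of_right _ ?_
    have hc := h.c_pos e
    have hcM : 0 < cM := hc.trans_le (h.le_cM e)
    have ih' := ih (dst e) (r / c e) (by
      rw [le_div_iff₀ hc]
      refine le_trans ?_ hr
      rw [pow_succ, ← mul_assoc]
      have := h.R_pos
      gcongr
      exact h.le_cM e)
    refine measure_mono_null ?_ (ae_iff.1 ih')
    intro x hx
    simp only [mem_preimage, mem_ofPred_eq] at hx ⊢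
    intro hcon
    apply hx
    rw [← he']
    refine le_trans ?_ (h.edge_le e Metric.isOpen_ball.measurableSet)
    rw [preimage_ball hc (h.sim e), pow_succ, mul_comm]
    gcongr
    exact h.pm_le e

lemma GD.dec_aux (h : GD src dst S c p μ cm cM pm R) (n : ℕ) (i : V) (r : ℝ)
    (hr : cM ^ n ≤ r) (hr2 : cm * r ≤ 1) : Dec μ i cm r := by
  induction n generalizing i r with
  | zero =>
    refine ⟨Unit, inferInstance, fun _ => 1, fun _ => id, fun _ => 1, fun _ => i, by simp,
      by simpa using hr2, by simpa using hr, by simp, by simp⟩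
  | succ n ih =>
    rcases le_or_gt 1 r with h1 | h1
    · exact ⟨Unit, inferInstance, fun _ => 1, fun _ => id, fun _ => 1, fun _ => i, by simp,
        by simpa using hr2, by simpa using h1, by simp, by simp⟩
    have hd : ∀ e, Dec μ (dst e) cm (r / c e) := by
      intro e
      have hc := h.c_pos e
      have hcM : 0 < cM := hc.trans_le (h.le_cM e)
      refine ih (dst e) _ ?_ ?_
      · rw [le_div_iff₀ hc]
        refine le_trans ?_ hr
        rw [pow_succ]
        gcongr
        exact h.le_cM e
      · rw [← mul_div_assoc, div_le_one hc]
        have := h.cm_le e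
        have := h.cm_pos
        nlinarith
    choose ι hι P T k t h1 h2 h3 h4 h5 using hd
    refine ⟨Σ e : {e // src e = i}, ι e, inferInstance,
      fun w => ENNReal.ofReal (p w.1) * P w.1 w.2, fun w => S w.1 ∘ T w.1 w.2,
      fun w => c w.1 * k w.1 w.2, fun w => t w.1 w.2, ?_, ?_, ?_, ?_, ?_⟩
    · exact fun w => mul_pos (h.c_pos _) (h1 _ _)
    · intro w
      have hc := h.c_pos w.1
      have := h2 w.1 w.2
      calc cm * r = c w.1 * (cm * (r / c w.1)) := by field_simp
        _ ≤ _ := mul_le_mul_of_nonneg_left this hc.le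
    · intro w
      have hc := h.c_pos w.1
      have := h3 w.1 w.2
      calc c w.1 * k w.1 w.2 ≤ c w.1 * (r / c w.1) := by gcongr
        _ = r := by field_simp
    · intro w x y
      simp only [Function.comp, h.sim, h4, mul_assoc]
    · intro A hA
      rw [h.apply i hA, Fintype.sum_sigma]
      rw [Finset.sum_subtype (Finset.univ.filter fun e => src e = i) (p := fun e => src e = i)
        (by simp)]
      refine Finset.sum_congr rfl fun e _ => ?_
      rw [h5 e _ ((simil_cont (h.c_pos e) (h.sim e)).measurable hA), Finset.mul_sum]
      refine Finset.sum_congr rfl fun w _ => ?_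
      rw [mul_assoc, preimage_comp]

lemma GD.dec (h : GD src dst S c p μ cm cM pm R) (hE : Nonempty E) (i : V) {r : ℝ}
    (hr : 0 < r) (hr1 : r ≤ 1) : Dec μ i cm r := by
  obtain ⟨e⟩ := hE
  have hcM : 0 < cM := (h.c_pos e).trans_le (h.le_cM e)
  obtain ⟨n, hn⟩ := exists_pow_lt_of_lt_one hr h.cM_lt
  refine h.dec_aux n i r hn.le ?_
  have := (h.cm_le e).trans (h.le_cM e)
  have := h.cM_lt
  have := h.cm_pos
  nlinarith

lemma GD.struct (h : GD src dst S c p μ cm cM pm R) (hE : Nonempty E) (i : V) {r : ℝ}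
    (hr : 0 < r) (hr1 : r ≤ 1) :
    ∃ (ι : Type) (_ : Fintype ι) (P : ι → ℝ≥0∞) (T : ι → Eu d → Eu d) (k : ι → ℝ) (t : ι → V)
      (M : ι → ℝ≥0∞),
    (∀ w, 0 < k w) ∧ (∀ w, cm * r ≤ k w) ∧ (∀ w, k w ≤ r) ∧
    (∀ w x y, dist (T w x) (T w y) = k w * dist x y) ∧
    (∀ w, P w ≠ ⊤) ∧
    (∀ A, MeasurableSet A → μ i A = ∑ w, P w * (μ (t w)).map (T w) A) ∧
    (∀ q, II q (μ i) ((4 * R + 2) * r) =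
      ∑ w, P w * ∫⁻ z, μ i (Metric.ball (T w z) ((4 * R + 2) * r)) ^ (q - 1) ∂(μ (t w))) ∧
    (∀ w, ∀ᵐ z ∂(μ (t w)), M w ≤ μ i (Metric.ball (T w z) ((4 * R + 2) * r))) ∧
    (∀ x ρ, ρ ≤ r → ∀ w, (μ (t w)).map (T w) (Metric.ball x ρ) ≠ 0 →
      ∑ w' ∈ Finset.univ.filter (fun w' => (μ (t w')).map (T w') (Metric.ball x ρ) ≠ 0), P w'
        ≤ M w) := by
  obtain ⟨ι, hι, P, T, k, t, h1, h2, h3, h4, h5⟩ := h.dec hE i hr hr1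
  have hprob := h.prob
  have hR := h.R_pos
  have hTm : ∀ w, Measurable (T w) := fun w => (simil_cont (h1 w) (h4 w)).measurable
  have hA : ∀ A, MeasurableSet A → μ i A = ∑ w, P w * (μ (t w)).map (T w) A := by
    intro A hA
    rw [h5 A hA]
    refine Finset.sum_congr rfl fun w _ => ?_
    rw [Measure.map_apply (hTm w) hA]
  have hmeas : μ i = ∑ w, P w • (μ (t w)).map (T w) := by
    refine Measure.ext fun A hA' => ?_
    rw [hA A hA', Measure.finsetSum_apply]
    rfl
  have hd0 : ∀ w, ∀ z ∈ Metric.ball (0 : Eu d) R, dist (T w z) (T w 0) < r * R := by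
    intro w z hz
    rw [h4]
    have := Metric.mem_ball.1 hz
    have h0 : 0 ≤ dist z 0 := dist_nonneg
    have := h1 w
    have := h3 w
    nlinarith
  refine ⟨ι, hι, P, T, k, t, fun w => μ i (Metric.ball (T w 0) ((3 * R + 2) * r)), h1, h2, h3, h4,
    ?_, hA, ?_, ?_, ?_⟩
  · intro w
    refine ne_top_of_le_ne_top ENNReal.one_ne_top ?_
    have := hA univ MeasurableSet.univ
    rw [measure_univ] at this
    rw [this]
    refine le_trans ?_ (Finset.single_le_sum (f := fun w => P w * (μ (t w)).map (T w) univ)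
      (fun _ _ => bot_le) (Finset.mem_univ w))
    rw [Measure.map_apply (hTm w) MeasurableSet.univ]; simp
  · intro q
    unfold II
    have hm := meas_ball_rpow (q - 1) (μ i) ((4 * R + 2) * r)
    have : ∀ f : Eu d → ℝ≥0∞, Measurable f →
        ∫⁻ x, f x ∂(μ i) = ∑ w, P w * ∫⁻ z, f (T w z) ∂(μ (t w)) := by
      intro f hf
      rw [hmeas, lintegral_finsetSum_measure]
      refine Finset.sum_congr rfl fun w _ => ?_
      rw [lintegral_smul_measure, lintegral_map hf (hTm w), smul_eq_mul]
    exact this _ hm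
  · intro w
    filter_upwards [h.supp (t w)] with z hz
    refine measure_mono (bsub_ball (s := r * R) ?_ (by linarith))
    rw [dist_comm]; exact (hd0 w z hz).le
  · intro x ρ hρ w hw
    have near : ∀ w, (μ (t w)).map (T w) (Metric.ball x ρ) ≠ 0 → dist x (T w 0) ≤ r * (R + 1) := by
      intro w hw
      rw [Measure.map_apply (hTm w) Metric.isOpen_ball.measurableSet] at hw
      by_contra! hcon
      apply hw
      refine measure_mono_null ?_ (ae_iff.1 (h.supp (t w)))
      intro z hz hz2
      have a1 := hd0 w z hz2
      have a2 := Metric.mem_ball.1 (mem_preimage.1 hz)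
      have a3 := dist_triangle x (T w z) (T w 0)
      rw [dist_comm x (T w z)] at a3
      linarith
    have hnw := near w hw
    beta_reduce
    rw [hA _ Metric.isOpen_ball.measurableSet]
    refine le_trans ?_ (Finset.sum_le_sum_of_subset (Finset.filter_subset
      (fun w' => (μ (t w')).map (T w') (Metric.ball x ρ) ≠ 0) Finset.univ))
    refine Finset.sum_le_sum fun w' hw' => ?_
    have hnw' := near w' (by simpa using hw')
    have : 1 ≤ (μ (t w')).map (T w') (Metric.ball (T w 0) ((3 * R + 2) * r)) := by
      rw [Measure.map_apply (hTm w') Metric.isOpen_ball.measurableSet]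
      refine h.one_le _ fun z hz => ?_
      have a1 := hd0 w' z hz
      have a2 := dist_triangle (T w' z) (T w' 0) (T w 0)
      have a3 := dist_triangle (T w' 0) x (T w 0)
      rw [dist_comm _ x] at a3
      rw [mem_preimage, Metric.mem_ball]
      linarith
    calc P w' = P w' * 1 := (mul_one _).symm
      _ ≤ _ := by gcongr

lemma GD.mult_big (h : GD src dst S c p μ cm cM pm R) (hE : Nonempty E) (i : V) {q : ℝ}
    (hq : 1 ≤ q) {r δ : ℝ} (hr : 0 < r) (hr1 : r ≤ 1) (hδ : 0 < δ) (hδ1 : δ ≤ 1) (B : ℝ≥0∞)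
    (hB : ∀ t, JJ q (μ t) (δ / cm) ≤ B) :
    JJ q (μ i) (r * δ) ≤ ENNReal.ofReal r ^ d * B * II q (μ i) ((4 * R + 2) * r) := by
  classical
  obtain ⟨ι, hι, P, T, k, t, M, h1, h2, h3, h4, hP, hA, hI, hM, hF⟩ := h.struct hE i hr hr1
  have hprob := h.prob
  have hTm : ∀ w, Measurable (T w) := fun w => (simil_cont (h1 w) (h4 w)).measurable
  have hpm : ∀ w, IsProbabilityMeasure ((μ (t w)).map (T w)) := fun w =>
    Measure.isProbabilityMeasure_map (hTm w).aemeasurable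
  calc JJ q (μ i) (r * δ) ≤ ∫⁻ x, ∑ w, P w * M w ^ (q - 1) *
        phi q ((μ (t w)).map (T w) (Metric.ball x (r * δ))) := by
        refine lintegral_mono fun x => ?_
        rw [hA _ Metric.isOpen_ball.measurableSet]
        exact jensen_convex hq Finset.univ P _ M hP (fun w => measure_ne_top _ _)
          (hF x (r * δ) (by nlinarith))
    _ = ∑ w, P w * M w ^ (q - 1) * JJ q ((μ (t w)).map (T w)) (r * δ) := by
        rw [lintegral_finsetSum]
        · refine Finset.sum_congr rfl fun w _ => ?_
          rw [lintegral_const_mul _ (meas_phi q _ _), JJ]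
        · intro w _
          exact (meas_phi q _ _).const_mul _
    _ ≤ ∑ w, (ENNReal.ofReal r ^ d * B) * (P w * ∫⁻ z,
          μ i (Metric.ball (T w z) ((4 * R + 2) * r)) ^ (q - 1) ∂(μ (t w))) := by
        refine Finset.sum_le_sum fun w _ => ?_
        have e1 : JJ q ((μ (t w)).map (T w)) (r * δ) ≤ ENNReal.ofReal r ^ d * B := by
          rw [JJ_map (h1 w) (h4 w)]
          refine mul_le_mul' ?_ (le_trans (JJ_mono (by linarith) _ ?_) (hB (t w)))
          · gcongr; exact h3 w
          · have := h.cm_pos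
            rw [div_le_div_iff₀ (h1 w) h.cm_pos]
            have := h2 w
            nlinarith
        have e2 : M w ^ (q - 1) ≤ ∫⁻ z,
          μ i (Metric.ball (T w z) ((4 * R + 2) * r)) ^ (q - 1) ∂(μ (t w)) := by
          calc M w ^ (q - 1) = ∫⁻ z, M w ^ (q - 1) ∂(μ (t w)) := by simp
            _ ≤ _ := lintegral_mono_ae ((hM w).mono fun z hz =>
                ENNReal.rpow_le_rpow hz (by linarith))
        rw [mul_comm (ENNReal.ofReal r ^ d * B)]
        exact mul_le_mul' (mul_le_mul' le_rfl e2) e1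
    _ = _ := by rw [← Finset.mul_sum, ← hI]

lemma GD.mult_small (h : GD src dst S c p μ cm cM pm R) (hE : Nonempty E) (i : V) {q : ℝ}
    (hq0 : 0 ≤ q) (hq : q ≤ 1) {r δ : ℝ} (hr : 0 < r) (hr1 : r ≤ 1) (hδ : 0 < δ) (hδ1 : δ ≤ 1)
    (B : ℝ≥0∞) (hB : ∀ t, B ≤ JJ q (μ t) δ) :
    ENNReal.ofReal (cm * r) ^ d * B * II q (μ i) ((4 * R + 2) * r) ≤ JJ q (μ i) (r * δ) := by
  classical
  obtain ⟨ι, hι, P, T, k, t, M, h1, h2, h3, h4, hP, hA, hI, hM, hF⟩ := h.struct hE i hr hr1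
  have hprob := h.prob
  have hTm : ∀ w, Measurable (T w) := fun w => (simil_cont (h1 w) (h4 w)).measurable
  have hpm : ∀ w, IsProbabilityMeasure ((μ (t w)).map (T w)) := fun w =>
    Measure.isProbabilityMeasure_map (hTm w).aemeasurable
  change JJ q (μ i) (r * δ) ≥ _
  calc JJ q (μ i) (r * δ) ≥ ∫⁻ x, ∑ w, P w * M w ^ (q - 1) *
        phi q ((μ (t w)).map (T w) (Metric.ball x (r * δ))) := by
        refine lintegral_mono fun x => ?_
        rw [hA _ Metric.isOpen_ball.measurableSet]
        exact jensen_concave hq0 hq Finset.univ P _ M hP (fun w => measure_ne_top _ _)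
          (hF x (r * δ) (by nlinarith))
    _ = ∑ w, P w * M w ^ (q - 1) * JJ q ((μ (t w)).map (T w)) (r * δ) := by
        rw [lintegral_finsetSum]
        · refine Finset.sum_congr rfl fun w _ => ?_
          rw [lintegral_const_mul _ (meas_phi q _ _), JJ]
        · intro w _
          exact (meas_phi q _ _).const_mul _
    _ ≥ ∑ w, (ENNReal.ofReal (cm * r) ^ d * B) * (P w * ∫⁻ z,
          μ i (Metric.ball (T w z) ((4 * R + 2) * r)) ^ (q - 1) ∂(μ (t w))) := by
        refine Finset.sum_le_sum fun w _ => ?_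
        have e1 : ENNReal.ofReal (cm * r) ^ d * B ≤ JJ q ((μ (t w)).map (T w)) (r * δ) := by
          rw [JJ_map (h1 w) (h4 w)]
          refine mul_le_mul' ?_ (le_trans (hB (t w)) (JJ_mono hq0 _ ?_))
          · gcongr; exact h2 w
          · rw [le_div_iff₀ (h1 w)]
            have := h3 w
            nlinarith
        have e2 : ∫⁻ z, μ i (Metric.ball (T w z) ((4 * R + 2) * r)) ^ (q - 1) ∂(μ (t w))
            ≤ M w ^ (q - 1) := by
          calc _ ≤ ∫⁻ z, M w ^ (q - 1) ∂(μ (t w)) := lintegral_mono_ae ((hM w).mono fun z hz =>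
                rpow_anti (by linarith) hz)
            _ = _ := by simp
        rw [mul_comm (ENNReal.ofReal (cm * r) ^ d * B)]
        exact mul_le_mul' (mul_le_mul' le_rfl e2) e1
    _ = _ := by rw [← Finset.mul_sum, ← hI]

lemma GD.compar (h : GD src dst S c p μ cm cM pm R)
    {q : ℝ} (hq : 0 ≤ q) (i j : V)
    (hij : Relation.ReflTransGen (fun a b : V => ∃ e, src e = a ∧ dst e = b) i j) :
    ∃ C : ℝ≥0∞, C ≠ ⊤ ∧ ∀ r, 0 < r → JJ q (μ j) r ≤ C * JJ q (μ i) r := by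
  have hprob := h.prob
  induction hij with
  | refl => exact ⟨1, by simp, by simp⟩
  | tail _ he ih =>
    obtain ⟨C, hC, hC2⟩ := ih
    obtain ⟨e, rfl, rfl⟩ := he
    have hc := h.c_pos e
    have hp : 0 < p e := h.pm_pos.trans_le (h.pm_le e)
    have hp0 : ENNReal.ofReal (p e) ≠ 0 := by simpa using hp
    have hTm : Measurable (S e) := (simil_cont hc (h.sim e)).measurable
    have hpm : IsProbabilityMeasure ((μ (dst e)).map (S e)) :=
      Measure.isProbabilityMeasure_map hTm.aemeasurable
    set K : ℝ≥0∞ := ENNReal.ofReal (p e) ^ q * ENNReal.ofReal (c e) ^ d with hK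
    have hK0 : K ≠ 0 := mul_ne_zero (by simp [ENNReal.rpow_eq_zero_iff, hp.not_ge])
      (pow_ne_zero _ (by simpa using hc))
    have hKt : K ≠ ⊤ := ENNReal.mul_ne_top (ENNReal.rpow_ne_top_of_nonneg hq (by simp))
      (ENNReal.pow_ne_top (by simp))
    refine ⟨K⁻¹ * C, ENNReal.mul_ne_top (ENNReal.inv_ne_top.2 hK0) hC, fun r hr => ?_⟩
    have key : K * JJ q (μ (dst e)) r ≤ JJ q (μ (src e)) r := by
      calc K * JJ q (μ (dst e)) r ≤ K * JJ q (μ (dst e)) (r / c e) := by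
            gcongr
            refine JJ_mono hq _ ?_
            rw [le_div_iff₀ hc]
            have := (h.le_cM e).trans h.cM_lt.le
            nlinarith
        _ = ENNReal.ofReal (p e) ^ q * JJ q ((μ (dst e)).map (S e)) r := by
            rw [JJ_map hc (h.sim e), hK]; ring
        _ = ∫⁻ x, phi q (ENNReal.ofReal (p e) * (μ (dst e)).map (S e) (Metric.ball x r)) := by
            rw [JJ, ← lintegral_const_mul _ (meas_phi q _ _)]
            refine lintegral_congr fun x => ?_
            rw [phi_mul q hp0 (by simp) (measure_ne_top _ _)]
        _ ≤ _ := by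
            refine lintegral_mono fun x => phi_mono hq ?_ (measure_ne_top _ _)
            rw [Measure.map_apply hTm Metric.isOpen_ball.measurableSet]
            exact h.edge_le e Metric.isOpen_ball.measurableSet
    calc JJ q (μ (dst e)) r = K⁻¹ * (K * JJ q (μ (dst e)) r) := by
          rw [← mul_assoc, ENNReal.inv_mul_cancel hK0 hKt, one_mul]
      _ ≤ K⁻¹ * (C * JJ q (μ i) r) := by
          exact mul_le_mul' le_rfl (key.trans (hC2 r hr))
      _ = _ := by ring

end

/-- Logarithm of an extended nonnegative real. -/
def lg (x : ℝ≥0∞) : ℝ := Real.log x.toReal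

lemma lg_mono {x y : ℝ≥0∞} (hx : x ≠ 0) (hy : y ≠ ⊤) (h : x ≤ y) : lg x ≤ lg y :=
  Real.log_le_log (ENNReal.toReal_pos hx (ne_top_of_le_ne_top hy h)) (ENNReal.toReal_mono hy h)

/-- Nonzero and finite. -/
def Fin0 (x : ℝ≥0∞) : Prop := x ≠ 0 ∧ x ≠ ⊤

lemma Fin0.mul {x y : ℝ≥0∞} (hx : Fin0 x) (hy : Fin0 y) : Fin0 (x * y) :=
  ⟨mul_ne_zero hx.1 hy.1, ENNReal.mul_ne_top hx.2 hy.2⟩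

lemma Fin0.pow {x : ℝ≥0∞} (hx : Fin0 x) (n : ℕ) : Fin0 (x ^ n) :=
  ⟨pow_ne_zero _ hx.1, ENNReal.pow_ne_top hx.2⟩

lemma Fin0.rpow {x : ℝ≥0∞} (hx : Fin0 x) (y : ℝ) : Fin0 (x ^ y) :=
  ⟨(ENNReal.rpow_pos (pos_iff_ne_zero.2 hx.1) hx.2).ne', ENNReal.rpow_ne_top_of_ne_zero hx.1 hx.2⟩

lemma Fin0.ofReal {r : ℝ} (hr : 0 < r) : Fin0 (ENNReal.ofReal r) := ⟨by simpa using hr, by simp⟩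

lemma Fin0.om (d : ℕ) : Fin0 (om d) := ⟨om_ne_zero d, om_ne_top d⟩

lemma Fin0.two : Fin0 2 := ⟨by simp, by simp⟩

lemma Fin0.lg_mul {x y : ℝ≥0∞} (hx : Fin0 x) (hy : Fin0 y) : lg (x * y) = lg x + lg y := by
  rw [lg, ENNReal.toReal_mul, Real.log_mul (ENNReal.toReal_ne_zero.2 hx)
    (ENNReal.toReal_ne_zero.2 hy)]; rfl

lemma lg_pow (x : ℝ≥0∞) (n : ℕ) : lg (x ^ n) = n * lg x := by
  rw [lg, ENNReal.toReal_pow, Real.log_pow, lg]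

lemma Fin0.lg_rpow {x : ℝ≥0∞} (hx : Fin0 x) (y : ℝ) : lg (x ^ y) = y * lg x := by
  rw [lg, ← ENNReal.toReal_rpow, Real.log_rpow (ENNReal.toReal_pos hx.1 hx.2), lg]

lemma lg_ofReal {r : ℝ} (hr : 0 < r) : lg (ENNReal.ofReal r) = Real.log r := by
  rw [lg, ENNReal.toReal_ofReal hr.le]

lemma lg_two : lg 2 = Real.log 2 := by simp [lg]

lemma Fin0.of_le {x y z : ℝ≥0∞} (hx : x ≠ 0) (hz : z ≠ ⊤) (h1 : x ≤ y) (h2 : y ≤ z) : Fin0 y :=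
  ⟨fun h => hx (le_antisymm (h ▸ h1) bot_le), ne_top_of_le_ne_top hz h2⟩

section
variable {d : ℕ} {V E : Type} [Fintype V] [Fintype E] [DecidableEq V] {src dst : E → V}
    {S : E → Eu d → Eu d} {c p : E → ℝ} {μ : V → Measure (Eu d)} {cm cM pm R : ℝ}

lemma GD.poly_exp (h : GD src dst S c p μ cm cM pm R) (hE : Nonempty E) :
    ∃ A B : ℝ, 0 < A ∧ 0 < B ∧ ∀ t, 0 ≤ t → ∃ n : ℕ, (n : ℝ) ≤ A + B * t ∧
      ∀ i, ∀ᵐ x ∂(μ i), ENNReal.ofReal pm ^ n ≤ μ i (Metric.ball x (Real.exp (-t))) := by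
  obtain ⟨e⟩ := hE
  have hcM : 0 < cM := (h.c_pos e).trans_le (h.le_cM e)
  have hR := h.R_pos
  set l := -Real.log cM with hl
  have hl0 : 0 < l := by have := Real.log_neg hcM h.cM_lt; linarith
  refine ⟨|Real.log (2 * R)| / l + 1, 1 / l, by positivity, by positivity, fun t ht => ?_⟩
  refine ⟨⌈(t + |Real.log (2 * R)|) / l⌉₊, ?_, fun i => h.poly _ i _ ?_⟩
  · have := (Nat.ceil_lt_add_one (show 0 ≤ (t + |Real.log (2 * R)|) / l by positivity)).le
    refine this.trans (le_of_eq ?_)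
    field_simp
    ring
  · have := Nat.le_ceil ((t + |Real.log (2 * R)|) / l)
    set n := ⌈(t + |Real.log (2 * R)|) / l⌉₊
    rw [div_le_iff₀ hl0] at this
    rw [← Real.log_le_log_iff (by positivity) (Real.exp_pos _), Real.log_exp,
      Real.log_mul (by positivity) (by positivity), Real.log_pow]
    have h2 := le_abs_self (Real.log (2 * R))
    have : (n : ℝ) * l = - (n * Real.log cM) := by rw [hl]; ring
    linarith

lemma GD.compar_unif (h : GD src dst S c p μ cm cM pm R)
    (hconn : ∀ i j : V, Relation.ReflTransGen (fun a b : V => ∃ e, src e = a ∧ dst e = b) i j)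
    {q : ℝ} (hq : 0 ≤ q) : ∃ C : ℝ≥0∞, Fin0 C ∧
      ∀ i j r, 0 < r → JJ q (μ j) r ≤ C * JJ q (μ i) r := by
  choose C hC hC2 using fun i j => h.compar hq i j (hconn i j)
  refine ⟨1 + ∑ i, ∑ j, C i j, ⟨by simp, ?_⟩, fun i j r hr => (hC2 i j r hr).trans ?_⟩
  · simp [ENNReal.sum_eq_top, hC]
  · gcongr
    refine le_trans ?_ le_add_self
    refine le_trans ?_ (Finset.single_le_sum (f := fun i => ∑ j, C i j) (fun _ _ => bot_le)
      (Finset.mem_univ i))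
    exact Finset.single_le_sum (f := fun j => C i j) (fun _ _ => bot_le) (Finset.mem_univ j)

lemma GD.JJ_le (h : GD src dst S c p μ cm cM pm R) {q : ℝ} (hq : 0 ≤ q) (i : V) {r : ℝ}
    (hr1 : r ≤ 1) : JJ q (μ i) r ≤ ENNReal.ofReal (R + 1) ^ d * om d := by
  have := h.prob
  have hR := h.R_pos
  rw [← vol_ball (0 : Eu d) (by linarith), ← lintegral_indicator_one Metric.isOpen_ball.measurableSet]
  refine lintegral_mono fun x => ?_
  by_cases hx : x ∈ Metric.ball (0 : Eu d) (R + 1)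
  · simpa [hx] using phi_le_one hq prob_le_one
  · have : μ i (Metric.ball x r) = 0 := by
      refine measure_mono_null ?_ (ae_iff.1 (h.supp i))
      intro z hz hz2
      apply hx
      have a1 := Metric.mem_ball.1 hz
      have a2 := Metric.mem_ball.1 hz2
      have a3 := dist_triangle x z 0
      rw [dist_comm x z] at a3
      rw [Metric.mem_ball]; linarith
    simp [this, phi_zero]

lemma one_le_II_small {q : ℝ} (hq : q ≤ 1) (ν : Measure (Eu d)) [IsProbabilityMeasure ν] (r : ℝ) :
    1 ≤ II q ν r := by
  calc (1 : ℝ≥0∞) = ∫⁻ _, 1 ∂ν := by simp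
    _ ≤ _ := by
      refine lintegral_mono fun x => ?_
      have := rpow_anti (show q - 1 ≤ 0 by linarith) (prob_le_one (μ := ν) (s := Metric.ball x r))
      simpa using this

lemma II_le_one_big {q : ℝ} (hq : 1 ≤ q) (ν : Measure (Eu d)) [IsProbabilityMeasure ν] (r : ℝ) :
    II q ν r ≤ 1 := by
  calc _ ≤ ∫⁻ _, 1 ∂ν := by
        refine lintegral_mono fun x => ?_
        have := ENNReal.rpow_le_rpow (prob_le_one (μ := ν) (s := Metric.ball x r))
          (show 0 ≤ q - 1 by linarith)
        simpa using this
    _ = 1 := by simp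

lemma GD.limit_small (h : GD src dst S c p μ cm cM pm R) (hE : Nonempty E) (i : V)
    (hconn : ∀ i j : V, Relation.ReflTransGen (fun a b : V => ∃ e, src e = a ∧ dst e = b) i j)
    {q : ℝ} (hq0 : 0 ≤ q) (hq : q ≤ 1) :
    ∃ L, ∀ j, Tendsto (fun t => lg (II q (μ j) (Real.exp (-t))) / t) atTop (𝓝 L) := by
  have hprob := h.prob
  have hR := h.R_pos
  obtain ⟨A, B, hA, hB, hpoly⟩ := h.poly_exp hE
  obtain ⟨C, hC, hcmp⟩ := h.compar_unif hconn hq0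
  obtain ⟨N, hN⟩ : ∃ N : ℕ, (1 : ℝ≥0∞) ≤ 2 ^ N * ENNReal.ofReal pm := by
    obtain ⟨N, hN⟩ := pow_unbounded_of_one_lt (pm⁻¹) (one_lt_two)
    refine ⟨N, ?_⟩
    have : (2 : ℝ≥0∞) ^ N = ENNReal.ofReal (2 ^ N) := by
      rw [ENNReal.ofReal_pow (by norm_num)]; simp
    rw [this, ← ENNReal.ofReal_mul (by positivity), ENNReal.one_le_ofReal]
    have := h.pm_pos
    calc (1 : ℝ) = pm⁻¹ * pm := by field_simp
      _ ≤ _ := by gcongr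
  have hJ : ∀ j t, 0 ≤ t → Fin0 (JJ q (μ j) (Real.exp (-t))) := by
    intro j t ht
    refine Fin0.of_le (x := ENNReal.ofReal (Real.exp (-t)) ^ d * om d * 1)
      ((((Fin0.ofReal (Real.exp_pos _)).pow d).mul (Fin0.om d)).mul ⟨by simp, by simp⟩).1
      (((Fin0.ofReal (by linarith : 0 < R + 1)).pow d).mul (Fin0.om d)).2 ?_
      (h.JJ_le hq0 j (by simpa using ht))
    refine le_trans ?_ (II_le_JJ_small hq (μ j) (Real.exp_pos _))
    gcongr
    exact one_le_II_small hq _ _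
  have hIup : ∀ j r, 0 < r → ENNReal.ofReal (r / 2) ^ d * om d * II q (μ j) r ≤ JJ q (μ j) (r / 2) := by
    intro j r hr
    have := II_le_JJ_small hq (μ j) (half_pos hr)
    rwa [mul_div_cancel₀ r (two_ne_zero)] at this
  have hI : ∀ j r, 0 < r → r ≤ 1 → Fin0 (II q (μ j) r) := by
    intro j r hr hr1
    refine ⟨fun h0 => by have := one_le_II_small hq (μ j) r; simp [h0] at this, fun ht => ?_⟩
    have h1 := (hIup j r hr).trans (h.JJ_le hq0 j (by linarith))
    rw [ht, ENNReal.mul_top ((((Fin0.ofReal (half_pos hr)).pow d).mul (Fin0.om d)).1)] at h1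
    exact (((Fin0.ofReal (by linarith : 0 < R + 1)).pow d).mul (Fin0.om d)).2 (top_le_iff.1 h1)
  -- lower bound of II by JJ
  have hlow : ∀ t, 0 ≤ t → ∃ m : ℕ, (m : ℝ) + 2 ≤ (N * A + 3) + (N * B + 1) * t ∧
      ∀ j ρ, 1 ≤ ρ → JJ q (μ j) (ρ * Real.exp (-t)) ≤
        2 * (ENNReal.ofReal ((m + 2) * (ρ * Real.exp (-t))) ^ d * om d) *
          II q (μ j) (ρ * Real.exp (-t)) := by
    intro t ht
    obtain ⟨n, hn, hn2⟩ := hpoly t ht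
    refine ⟨N * n + 1, ?_, fun j ρ hρ => ?_⟩
    · push_cast
      have : (N : ℝ) * n ≤ N * (A + B * t) := by gcongr
      nlinarith
    · refine JJ_le_II_small hq0 hq (μ j) (by positivity) (ENNReal.ofReal pm ^ n) (N * n + 1) ?_ ?_
      · filter_upwards [hn2 j] with x hx
        refine hx.trans (measure_mono (Metric.ball_subset_ball ?_))
        have := Real.exp_pos (-t)
        nlinarith
      · have h1 : (1 : ℝ≥0∞) ≤ 2 ^ (N * n) * ENNReal.ofReal pm ^ n := by
          rw [pow_mul, ← mul_pow]; exact one_le_pow₀ hN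
        calc (1 : ℝ≥0∞) < 2 := by norm_num
          _ = 2 * 1 := by simp
          _ ≤ 2 * (2 ^ (N * n) * ENNReal.ofReal pm ^ n) := by gcongr
          _ = _ := by ring
  have hρ1 : 1 ≤ 4 * R + 2 := by linarith
  -- II at the scale `ρ r` is finite
  have hII : ∀ j t ρ, 1 ≤ ρ → 0 ≤ t → Fin0 (II q (μ j) (ρ * Real.exp (-t))) := by
    intro j t ρ hρ ht
    have hle : II q (μ j) (ρ * Real.exp (-t)) ≤ II q (μ j) (Real.exp (-t)) := by
      refine lintegral_mono fun x => rpow_anti (by linarith) (measure_mono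
        (Metric.ball_subset_ball ?_))
      have := Real.exp_pos (-t)
      nlinarith
    refine ⟨fun h0 => by have := one_le_II_small hq (μ j) (ρ * Real.exp (-t)); simp [h0] at this, 
      ne_top_of_le_ne_top (hI j _ (Real.exp_pos _) (by simpa using ht)).2 hle⟩
  set a : V → ℝ → ℝ := fun j t => lg (JJ q (μ j) (Real.exp (-t))) + d * t with ha
  set Er : ℝ → ℝ := fun t => (Real.log 2 + lg (om d)) +
      d * Real.log ((N * A + 3) + (N * B + 1) * t) with hEr
  have hIlow : ∀ j t ρ, 0 ≤ t → 1 ≤ ρ →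
      a j t - Er t - d * Real.log ρ ≤ lg (II q (μ j) (ρ * Real.exp (-t))) := by
    intro j t ρ ht hρ
    obtain ⟨m, hm, hm2⟩ := hlow t ht
    have hX : Fin0 (ENNReal.ofReal ((m + 2) * (ρ * Real.exp (-t)))) := Fin0.ofReal (by positivity)
    have hY := Fin0.two.mul ((hX.pow d).mul (Fin0.om d))
    have h1 := lg_mono (hJ j t ht).1 (hY.mul (hII j t ρ hρ ht)).2
      ((JJ_mono hq0 (μ j) (by have := Real.exp_pos (-t); nlinarith)).trans (hm2 j ρ hρ))
    rw [hY.lg_mul (hII j t ρ hρ ht), Fin0.two.lg_mul ((hX.pow d).mul (Fin0.om d)),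
      (hX.pow d).lg_mul (Fin0.om d), lg_pow, lg_ofReal (by positivity), lg_two,
      Real.log_mul (by positivity) (by positivity), Real.log_mul (by positivity) (by positivity),
      Real.log_exp] at h1
    have h2 : Real.log (m + 2) ≤ Real.log ((N * A + 3) + (N * B + 1) * t) :=
      Real.log_le_log (by positivity) hm
    have h3 : (d : ℝ) * Real.log (m + 2) ≤ d * Real.log ((N * A + 3) + (N * B + 1) * t) := by gcongr
    simp only [ha, hEr]
    linarith
  have hacmp : ∀ j k t, 0 ≤ t → a j t ≤ a k t + lg C := by
    intro j k t ht
    have h1 := lg_mono (hJ j t ht).1 (hC.mul (hJ k t ht)).2 (hcmp k j _ (Real.exp_pos _))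
    rw [hC.lg_mul (hJ k t ht)] at h1
    simp only [ha]; linarith
  obtain ⟨L, hL⟩ := fekete (a i) (fun t => (Real.log 2 + lg (om d) - d * Real.log cm + lg C +
      d * Real.log (4 * R + 2)) + d * Real.log ((N * A + 3) + (N * B + 1) * t))
    (|lg (om d)| + |d * Real.log (R + 1) + lg (om d)| + d) (by
      intro t ht
      have hX : Fin0 (ENNReal.ofReal (Real.exp (-t)) ^ d * om d) :=
        ((Fin0.ofReal (Real.exp_pos _)).pow d).mul (Fin0.om d)
      have hY : Fin0 (ENNReal.ofReal (R + 1) ^ d * om d) :=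
        ((Fin0.ofReal (by linarith)).pow d).mul (Fin0.om d)
      have h1 := lg_mono (hJ i t ht).1 hY.2 (h.JJ_le hq0 i (by simpa using ht))
      have h2 := lg_mono hX.1 (hJ i t ht).2 (by
        refine le_trans ?_ (II_le_JJ_small hq (μ i) (Real.exp_pos _))
        calc _ = ENNReal.ofReal (Real.exp (-t)) ^ d * om d * 1 := by rw [mul_one]
          _ ≤ _ := by
            gcongr
            exact one_le_II_small hq _ _)
      rw [((Fin0.ofReal (by linarith)).pow d).lg_mul (Fin0.om d), lg_pow,
        lg_ofReal (by linarith)] at h1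
      rw [((Fin0.ofReal (Real.exp_pos _)).pow d).lg_mul (Fin0.om d), lg_pow,
        lg_ofReal (Real.exp_pos _), Real.log_exp] at h2
      have b1 := le_abs_self (d * Real.log (R + 1) + lg (om d))
      have b2 := neg_abs_le (lg (om d))
      have b3 := abs_nonneg (d * Real.log (R + 1) + lg (om d))
      have b4 := abs_nonneg (lg (om d))
      have b5 : (0 : ℝ) ≤ d * t := by positivity
      have b6 : (0 : ℝ) ≤ d := by positivity
      have b7 := mul_nonneg b3 ht
      have b8 := mul_nonneg b4 ht
      simp only [ha]
      rw [abs_le]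
      constructor <;> nlinarith) (by
      intro t s ht hs
      have hs' : Real.exp (-s) ≤ 1 := by simpa using hs
      have ht' : Real.exp (-t) ≤ 1 := by simpa using ht
      have hCi : Fin0 C⁻¹ := ⟨by simpa using hC.2, by simpa using hC.1⟩
      have h1 := h.mult_small hE i hq0 hq (Real.exp_pos _) ht' (Real.exp_pos _) hs'
        (C⁻¹ * JJ q (μ i) (Real.exp (-s))) (by
          intro k
          calc _ ≤ C⁻¹ * (C * JJ q (μ k) (Real.exp (-s))) :=
                mul_le_mul' le_rfl (hcmp k i _ (Real.exp_pos _))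
            _ = _ := by rw [← mul_assoc, ENNReal.inv_mul_cancel hC.1 hC.2, one_mul])
      rw [← Real.exp_add, ← neg_add] at h1
      have hcm := h.cm_pos
      have hX : Fin0 (ENNReal.ofReal (cm * Real.exp (-t))) := Fin0.ofReal (by positivity)
      have hY := hCi.mul (hJ i s hs)
      have hZ := hII i t _ hρ1 ht
      have h2 := lg_mono (((hX.pow d).mul hY).mul hZ).1 (hJ i (t + s) (by positivity)).2 h1
      have hCl : lg C⁻¹ = - lg C := by simp [lg]
      rw [((hX.pow d).mul hY).lg_mul hZ, (hX.pow d).lg_mul hY, hCi.lg_mul (hJ i s hs), lg_pow,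
        lg_ofReal (by positivity), Real.log_mul (by positivity) (by positivity), Real.log_exp,
        hCl] at h2
      have h3 := hIlow i t _ ht hρ1
      simp only [ha, hEr] at h3 ⊢
      linarith) (log_err _ _ _ _ (by positivity))
  refine ⟨L, fun j => ?_⟩
  refine sandwich_lim (a i) _ (fun t => (|Real.log 2 + lg (om d)| + |lg C| + |lg (om d)|) +
    d * Real.log ((N * A + 3) + (N * B + 1) * t)) L 0 (Real.log 2) hL
    (log_err _ _ _ _ (by positivity)) ?_ ?_
  · filter_upwards [eventually_ge_atTop 0] with t ht
    have h1 := hIlow j t 1 ht le_rfl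
    have h2 := hacmp i j t ht
    simp only [one_mul, Real.log_one, mul_zero, add_zero, hEr] at h1 ⊢
    have b1 := le_abs_self (Real.log 2 + lg (om d))
    have b2 := le_abs_self (lg C)
    have b3 := abs_nonneg (lg (om d))
    linarith
  · filter_upwards [eventually_ge_atTop 0] with t ht
    have hl2 : 0 < Real.log 2 := Real.log_pos one_lt_two
    have e : Real.exp (-t) / 2 = Real.exp (-(t + Real.log 2)) := by
      rw [neg_add, Real.exp_add, Real.exp_neg (Real.log 2), Real.exp_log two_pos]; rfl
    have h1 := hIup j _ (Real.exp_pos (-t))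
    rw [e] at h1
    have hX : Fin0 (ENNReal.ofReal (Real.exp (-(t + Real.log 2)))) := Fin0.ofReal (Real.exp_pos _)
    have hY := hI j _ (Real.exp_pos (-t)) (by simpa using ht)
    have h2 := lg_mono (((hX.pow d).mul (Fin0.om d)).mul hY).1 (hJ j (t + Real.log 2)
      (by positivity)).2 h1
    rw [((hX.pow d).mul (Fin0.om d)).lg_mul hY, (hX.pow d).lg_mul (Fin0.om d), lg_pow,
      lg_ofReal (Real.exp_pos _), Real.log_exp] at h2
    have h3 := hacmp j i (t + Real.log 2) (by positivity)
    have b1 := abs_nonneg (Real.log 2 + lg (om d))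
    have b2 := le_abs_self (lg C)
    have b3 := neg_abs_le (lg (om d))
    have b4 : (0 : ℝ) ≤ d * Real.log ((N * A + 3) + (N * B + 1) * t) := by
      refine mul_nonneg (by positivity) (Real.log_nonneg ?_)
      have : (0 : ℝ) ≤ (N * B + 1) * t := by positivity
      have : (0 : ℝ) ≤ N * A := by positivity
      linarith
    simp only [ha] at h3 ⊢
    linarith

lemma GD.limit_big (h : GD src dst S c p μ cm cM pm R) (hE : Nonempty E) (i : V)
    (hconn : ∀ i j : V, Relation.ReflTransGen (fun a b : V => ∃ e, src e = a ∧ dst e = b) i j)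
    {q : ℝ} (hq : 1 ≤ q) :
    ∃ L, ∀ j, Tendsto (fun t => lg (II q (μ j) (Real.exp (-t))) / t) atTop (𝓝 L) := by
  have hprob := h.prob
  have hR := h.R_pos
  have hcm := h.cm_pos
  have hq0 : 0 ≤ q := by linarith
  obtain ⟨A, B, hA, hB, hpoly⟩ := h.poly_exp hE
  obtain ⟨C, hC, hcmp⟩ := h.compar_unif hconn hq0
  obtain ⟨C2', hC2', hdb2'⟩ := JJ_doubling d hq0 (1 / cm)
  obtain ⟨C3', hC3', hdb3'⟩ := JJ_doubling d hq0 (2 * (4 * R + 2))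
  obtain ⟨C2, hC2, hdb2⟩ : ∃ C2, Fin0 C2 ∧ ∀ j r, 0 < r →
      JJ q (μ j) (1 / cm * r) ≤ C2 * JJ q (μ j) r :=
    ⟨C2' + 1, ⟨by simp, by simpa using hC2'⟩, fun j r hr => (hdb2' (μ j) r hr).trans
      (mul_le_mul' le_self_add le_rfl)⟩
  obtain ⟨C3, hC3, hdb3⟩ : ∃ C3, Fin0 C3 ∧ ∀ j r, 0 < r →
      JJ q (μ j) (2 * (4 * R + 2) * r) ≤ C3 * JJ q (μ j) r :=
    ⟨C3' + 1, ⟨by simp, by simpa using hC3'⟩, fun j r hr => (hdb3' (μ j) r hr).trans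
      (mul_le_mul' le_self_add le_rfl)⟩
  have hpm : Fin0 (ENNReal.ofReal pm) := Fin0.ofReal h.pm_pos
  -- lower bound for II
  have hIlow : ∀ t, 0 ≤ t → ∃ n : ℕ, (n : ℝ) ≤ A + B * t ∧ ∀ j ρ, 1 ≤ ρ →
      (ENNReal.ofReal pm ^ n) ^ (q - 1) ≤ II q (μ j) (ρ * Real.exp (-t)) := by
    intro t ht
    obtain ⟨n, hn, hn2⟩ := hpoly t ht
    refine ⟨n, hn, fun j ρ hρ => ?_⟩
    calc (ENNReal.ofReal pm ^ n) ^ (q - 1) = ∫⁻ _, (ENNReal.ofReal pm ^ n) ^ (q - 1) ∂(μ j) := by simp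
      _ ≤ _ := by
        refine lintegral_mono_ae ((hn2 j).mono fun x hx => ENNReal.rpow_le_rpow ?_ (by linarith))
        refine hx.trans (measure_mono (Metric.ball_subset_ball ?_))
        have := Real.exp_pos (-t)
        nlinarith
  have hI : ∀ j t ρ, 1 ≤ ρ → 0 ≤ t → Fin0 (II q (μ j) (ρ * Real.exp (-t))) := by
    intro j t ρ hρ ht
    obtain ⟨n, hn, hn2⟩ := hIlow t ht
    exact Fin0.of_le ((hpm.pow n).rpow _).1 ENNReal.one_ne_top (hn2 j ρ hρ)
      (II_le_one_big hq _ _)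
  have hl2 : 0 < Real.log 2 := Real.log_pos one_lt_two
  have e : ∀ t, Real.exp (-t) = 2 * Real.exp (-(t + Real.log 2)) := by
    intro t
    rw [neg_add, Real.exp_add, Real.exp_neg (Real.log 2), Real.exp_log two_pos]; ring
  have hJup : ∀ j r, 0 < r → JJ q (μ j) r ≤ ENNReal.ofReal r ^ d * om d := by
    intro j r hr
    refine (JJ_le_II_big hq (μ j) hr).trans ?_
    calc _ ≤ ENNReal.ofReal r ^ d * om d * 1 := mul_le_mul' le_rfl (II_le_one_big hq _ _)
      _ = _ := mul_one _
  have hX : ∀ r, 0 < r → Fin0 (ENNReal.ofReal r ^ d * om d) := fun r hr =>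
    ((Fin0.ofReal hr).pow d).mul (Fin0.om d)
  have hlX : ∀ r, 0 < r → lg (ENNReal.ofReal r ^ d * om d) = d * Real.log r + lg (om d) := by
    intro r hr
    rw [((Fin0.ofReal hr).pow d).lg_mul (Fin0.om d), lg_pow, lg_ofReal hr]
  have hJlow : ∀ j t, 0 ≤ t → ENNReal.ofReal (Real.exp (-(t + Real.log 2))) ^ d * om d *
      II q (μ j) (1 * Real.exp (-(t + Real.log 2))) ≤ JJ q (μ j) (Real.exp (-t)) := by
    intro j t ht
    rw [e t, one_mul]
    exact II_le_JJ_big hq (μ j) (Real.exp_pos _)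
  have hJ : ∀ j t, 0 ≤ t → Fin0 (JJ q (μ j) (Real.exp (-t))) := by
    intro j t ht
    exact Fin0.of_le ((hX _ (Real.exp_pos _)).mul (hI j (t + Real.log 2) 1 le_rfl
      (by positivity))).1 (hX _ (Real.exp_pos _)).2 (hJlow j t ht) (hJup j _ (Real.exp_pos _))
  set a : V → ℝ → ℝ := fun j t => lg (JJ q (μ j) (Real.exp (-t))) + d * t with ha
  have hacmp : ∀ j k t, 0 ≤ t → a j t ≤ a k t + lg C := by
    intro j k t ht
    have h1 := lg_mono (hJ j t ht).1 (hC.mul (hJ k t ht)).2 (hcmp k j _ (Real.exp_pos _))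
    rw [hC.lg_mul (hJ k t ht)] at h1
    simp only [ha]; linarith
  have hρ0 : 0 < 4 * R + 2 := by linarith
  have cerr : ∀ K : ℝ, Tendsto (fun t : ℝ => K / t) atTop (𝓝 0) := fun K =>
    tendsto_const_nhds.div_atTop tendsto_id
  obtain ⟨L, hL⟩ := fekete (fun t => -(a i t)) (fun _ => lg C2 + lg C + lg C3 -
      d * Real.log (4 * R + 2) - lg (om d))
    (|lg (om d)| + d * Real.log 2 + (q - 1) * (A + B * Real.log 2 + B) * |Real.log pm|) (by
      intro t ht
      have h1 := lg_mono (hJ i t ht).1 (hX _ (Real.exp_pos _)).2 (hJup i _ (Real.exp_pos _))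
      obtain ⟨n, hn, hn2⟩ := hIlow (t + Real.log 2) (by positivity)
      have hY := (hpm.pow n).rpow (q - 1)
      have h2 := lg_mono ((hX _ (Real.exp_pos _)).mul hY).1 (hJ i t ht).2
        ((mul_le_mul' le_rfl (hn2 i 1 le_rfl)).trans (hJlow i t ht))
      rw [hlX _ (Real.exp_pos _), Real.log_exp] at h1
      rw [(hX _ (Real.exp_pos _)).lg_mul hY, hlX _ (Real.exp_pos _), Real.log_exp,
        (hpm.pow n).lg_rpow, lg_pow, lg_ofReal h.pm_pos] at h2
      have b1 := le_abs_self (lg (om d))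
      have b2 := neg_abs_le (lg (om d))
      have b3 := neg_abs_le (Real.log pm)
      have b4 := abs_nonneg (Real.log pm)
      have b5 := abs_nonneg (lg (om d))
      have hq1 : 0 ≤ q - 1 := by linarith
      have b6 : (q - 1) * (n * -|Real.log pm|) ≤ (q - 1) * (n * Real.log pm) := by gcongr
      have b7 : (q - 1) * (n * |Real.log pm|) ≤
          (q - 1) * ((A + B * (t + Real.log 2)) * |Real.log pm|) := by gcongr
      have b8 : (q - 1) * ((A + B * (t + Real.log 2)) * |Real.log pm|) ≤
          (q - 1) * (A + B * Real.log 2 + B) * |Real.log pm| * (1 + t) := by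
        have e1 : A + B * (t + Real.log 2) ≤ (A + B * Real.log 2 + B) * (1 + t) := by
          have : 0 ≤ A * t := by positivity
          have : 0 ≤ B * Real.log 2 * t := by positivity
          nlinarith
        calc _ ≤ (q - 1) * (((A + B * Real.log 2 + B) * (1 + t)) * |Real.log pm|) := by gcongr
          _ = _ := by ring
      have b9 : 0 ≤ (q - 1) * (A + B * Real.log 2 + B) * |Real.log pm| * (1 + t) := by positivity
      have b10 : 0 ≤ (d : ℝ) * Real.log 2 := by positivity
      have b11 := mul_nonneg b10 ht
      have b12 := mul_nonneg b5 ht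
      simp only [ha, abs_neg]
      rw [abs_le]
      constructor <;> nlinarith) (by
      intro t s ht hs
      have hs' : Real.exp (-s) ≤ 1 := by simpa using hs
      have ht' : Real.exp (-t) ≤ 1 := by simpa using ht
      have hB' := hC2.mul (hC.mul (hJ i s hs))
      have h1 := h.mult_big hE i hq (Real.exp_pos _) ht' (Real.exp_pos _) hs'
        (C2 * (C * JJ q (μ i) (Real.exp (-s)))) (by
          intro k
          rw [div_eq_mul_one_div, mul_comm (Real.exp (-s))]
          exact (hdb2 k _ (Real.exp_pos _)).trans (mul_le_mul' le_rfl (hcmp i k _ (Real.exp_pos _))))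
      rw [← Real.exp_add, ← neg_add] at h1
      have hZ : Fin0 (II q (μ i) ((4 * R + 2) * Real.exp (-t))) := hI i t _ (by linarith) ht
      have hW := (Fin0.ofReal (Real.exp_pos (-t))).pow d
      have h2 := lg_mono (hJ i (t + s) (by positivity)).1 ((hW.mul hB').mul hZ).2 h1
      rw [(hW.mul hB').lg_mul hZ, hW.lg_mul hB', hC2.lg_mul (hC.mul (hJ i s hs)),
        hC.lg_mul (hJ i s hs), lg_pow, lg_ofReal (Real.exp_pos _), Real.log_exp] at h2
      have hρt : 0 < (4 * R + 2) * Real.exp (-t) := by positivity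
      have h3 := II_le_JJ_big hq (μ i) hρt
      rw [← mul_assoc 2 (4 * R + 2)] at h3
      replace h3 := h3.trans (hdb3 i _ (Real.exp_pos (-t)))
      have h4 := lg_mono ((hX _ hρt).mul hZ).1 (hC3.mul (hJ i t ht)).2 h3
      rw [(hX _ hρt).lg_mul hZ, hlX _ hρt, hC3.lg_mul (hJ i t ht),
        Real.log_mul (by positivity) (by positivity), Real.log_exp] at h4
      simp only [ha]
      linarith) (cerr _)
  have hL' : Tendsto (fun t => a i t / t) atTop (𝓝 (-L)) := by
    refine hL.neg.congr fun t => ?_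
    ring
  refine ⟨-L, fun j => ?_⟩
  refine sandwich_lim (a i) _ (fun _ => |lg C| + |lg (om d)| + d * Real.log 2) (-L) (Real.log 2)
    (-Real.log 2) hL' (cerr _) ?_ ?_
  · filter_upwards [eventually_ge_atTop 0] with t ht
    have h1 := JJ_le_II_big hq (μ j) (Real.exp_pos (-(t + Real.log 2)))
    rw [← e] at h1
    have hY := hI j t 1 le_rfl ht
    rw [one_mul] at hY
    have h2 := lg_mono (hJ j (t + Real.log 2) (by positivity)).1
      ((hX _ (Real.exp_pos _)).mul hY).2 h1
    rw [(hX _ (Real.exp_pos _)).lg_mul hY, hlX _ (Real.exp_pos _), Real.log_exp] at h2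
    have h3 := hacmp i j (t + Real.log 2) (by positivity)
    have b1 := le_abs_self (lg C)
    have b2 := le_abs_self (lg (om d))
    have b10 : 0 ≤ (d : ℝ) * Real.log 2 := by positivity
    simp only [ha] at h3 ⊢
    linarith
  · filter_upwards [eventually_ge_atTop (Real.log 2)] with t ht
    have ht0 : 0 ≤ t := by linarith
    have ht1 : 0 ≤ t + -Real.log 2 := by linarith
    have h1 := II_le_JJ_big hq (μ j) (Real.exp_pos (-t))
    have e2 : 2 * Real.exp (-t) = Real.exp (-(t + -Real.log 2)) := by
      rw [e (t + -Real.log 2)]; ring_nf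
    rw [e2] at h1
    have hY := hI j t 1 le_rfl ht0
    rw [one_mul] at hY
    have h2 := lg_mono ((hX _ (Real.exp_pos _)).mul hY).1 (hJ j _ ht1).2 h1
    rw [(hX _ (Real.exp_pos _)).lg_mul hY, hlX _ (Real.exp_pos _), Real.log_exp] at h2
    have h3 := hacmp j i _ ht1
    have b1 := le_abs_self (lg C)
    have b2 := neg_abs_le (lg (om d))
    simp only [ha] at h3 ⊢
    linarith

lemma GD.limit (h : GD src dst S c p μ cm cM pm R) (hE : Nonempty E) (i : V)
    (hconn : ∀ i j : V, Relation.ReflTransGen (fun a b : V => ∃ e, src e = a ∧ dst e = b) i j)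
    {q : ℝ} (hq : 0 ≤ q) :
    ∃ L, ∀ j, Tendsto (fun t => lg (II q (μ j) (Real.exp (-t))) / t) atTop (𝓝 L) := by
  rcases le_total q 1 with h1 | h1
  · exact h.limit_small hE i hconn hq h1
  · exact h.limit_big hE i hconn h1

lemma GD.integral_eq (h : GD src dst S c p μ cm cM pm R) (hE : Nonempty E) (q : ℝ) (j : V)
    {δ : ℝ} (hδ : 0 < δ) :
    ∫ x, (μ j (Metric.ball x δ)).toReal ^ (q - 1) ∂(μ j) = (II q (μ j) δ).toReal := by
  have := h.prob
  obtain ⟨e⟩ := hE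
  have hcM : 0 < cM := (h.c_pos e).trans_le (h.le_cM e)
  have hR := h.R_pos
  obtain ⟨n, hn⟩ := exists_pow_lt_of_lt_one (show 0 < δ / (2 * R) by positivity) h.cM_lt
  rw [lt_div_iff₀ (by positivity)] at hn
  have hp := h.poly n j δ (by linarith)
  simp_rw [ENNReal.toReal_rpow]
  refine integral_toReal (meas_ball_rpow _ _ _).aemeasurable ?_
  filter_upwards [hp] with x hx
  refine (ENNReal.rpow_ne_top_of_ne_zero (fun h0 => ?_) (measure_ne_top _ _)).lt_top
  rw [h0] at hx
  exact ((Fin0.ofReal h.pm_pos).pow n).1 (le_antisymm hx bot_le)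

end

end helpers

open scoped Topology

/-- **Theorem (existence of `L^q`-spectra for graph-directed self-similar measures).**
For every family of graph-directed self-similar measures `(μ i)_{i ∈ V}`, driven by a finite
strongly connected directed multigraph with edge set `E` (an edge `e` going from `src e` to
`dst e`, carrying a contracting similarity `S e` with ratio `c e ∈ (0,1)` and a probability
`p e ∈ (0,1)` with `∑_{e : src e = i} p e = 1` for every vertex), the `L^q`-spectrum exists
for all `q ≥ 0` and is the same for each of the measures `μ i`. -/
theorem lq_spectrum_exists_for_graph_directed_self_similar_measures
    {d : ℕ} {V E : Type} [Fintype V] [Fintype E] [Nonempty V] [DecidableEq V]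
    (src dst : E → V)
    (hconn : ∀ i j : V, Relation.ReflTransGen (fun a b : V => ∃ e, src e = a ∧ dst e = b) i j)
    (S : E → EuclideanSpace ℝ (Fin d) → EuclideanSpace ℝ (Fin d))
    (c : E → ℝ) (hc : ∀ e, c e ∈ Set.Ioo (0 : ℝ) 1)
    (hS : ∀ e x y, dist (S e x) (S e y) = c e * dist x y)
    (p : E → ℝ) (hp : ∀ e, p e ∈ Set.Ioo (0 : ℝ) 1)
    (hpsum : ∀ i : V, ∑ e ∈ Finset.univ.filter fun e => src e = i, p e = 1)
    (μ : V → Measure (EuclideanSpace ℝ (Fin d)))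
    (hprob : ∀ i, IsProbabilityMeasure (μ i))
    (hcpt : ∀ i, ∃ K : Set (EuclideanSpace ℝ (Fin d)), IsCompact K ∧ μ i Kᶜ = 0)
    (hμ : ∀ i : V, μ i =
      ∑ e ∈ Finset.univ.filter fun e => src e = i,
        ENNReal.ofReal (p e) • Measure.map (S e) (μ (dst e))) :
    ∀ q : ℝ, 0 ≤ q → ∀ i j : V,
      lowerLq (μ i) q = upperLq (μ i) q ∧ lowerLq (μ i) q = lowerLq (μ j) q := by
  obtain ⟨i0⟩ := ‹Nonempty V›
  have hE : Nonempty E := by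
    by_contra hne
    rw [not_nonempty_iff] at hne
    have := hpsum i0
    simp at this
  obtain ⟨e1, he1⟩ := Finite.exists_min c
  obtain ⟨e2, he2⟩ := Finite.exists_max c
  obtain ⟨e3, he3⟩ := Finite.exists_min p
  have hb : ∀ i, ∃ r : ℝ, μ i (Metric.ball 0 r)ᶜ = 0 := by
    intro i
    obtain ⟨K, hK, h0⟩ := hcpt i
    obtain ⟨r, hr⟩ := hK.isBounded.subset_ball 0
    exact ⟨r, measure_mono_null (compl_subset_compl.2 hr) h0⟩
  choose r hr using hb
  have hgd : GD src dst S c p μ (c e1) (c e2) (p e3) (1 + ∑ i, |r i|) :=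
    { cm_pos := (hc e1).1
      cM_lt := (hc e2).2
      cm_le := he1
      le_cM := he2
      sim := hS
      pm_pos := (hp e3).1
      pm_le := he3
      prob := hprob
      R_pos := by positivity
      supp := by
        intro i
        refine measure_mono_null (compl_subset_compl.2 (Metric.ball_subset_ball ?_)) (hr i)
        have := Finset.single_le_sum (f := fun i => |r i|) (fun i _ => abs_nonneg (r i))
          (Finset.mem_univ i)
        have h2 := le_abs_self (r i)
        linarith
      self := hμ }
  intro q hq i j
  obtain ⟨L, hL⟩ := hgd.limit hE i0 hconn hq
  have key : ∀ j, Tendsto (fun δ : ℝ =>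
      Real.log (∫ x, (μ j (Metric.ball x δ)).toReal ^ (q - 1) ∂(μ j)) / (-Real.log δ))
      (nhdsWithin 0 (Set.Ioi 0)) (𝓝 L) := by
    intro j
    have h1 : Tendsto (fun δ : ℝ => -Real.log δ) (nhdsWithin 0 (Set.Ioi 0)) atTop :=
      tendsto_neg_atBot_atTop.comp Real.tendsto_log_nhdsGT_zero
    refine ((hL j).comp h1).congr' ?_
    filter_upwards [self_mem_nhdsWithin] with δ hδ
    have hδ' : 0 < δ := hδ
    simp only [Function.comp, neg_neg, Real.exp_log hδ', lg]
    rw [hgd.integral_eq hE q j hδ']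
  have hl : ∀ j, lowerLq (μ j) q = L := fun j => (key j).liminf_eq
  have hu : ∀ j, upperLq (μ j) q = L := fun j => (key j).limsup_eq
  exact ⟨(hl i).trans (hu i).symm, (hl i).trans (hl j).symm⟩
end
end

section
/- Let q ≥ 0 and s ∈ ℝ. (a) For all finite words i, j ∈ I^* (with ij denoting concatenation): if s < τ_1(q)+τ_2(q) then ψ^{s,q}(ij) ≤ ψ^{s,q}(i)·ψ^{s,q}(j); if s = τ_1(q)+τ_2(q) then ψ^{s,q}(ij) = ψ^{s,q}(i)·ψ^{s,q}(j); if s > τ_1(q)+τ_2(q) then ψ^{s,q}(ij) ≥ ψ^{s,q}(i)·ψ^{s,q}(j). (b) Consequently, for all k, l ∈ ℕ: Ψ_{k+l}^{s,q} ≤ Ψ_k^{s,q}·Ψ_l^{s,q} if s < τ_1(q)+τ_2(q); Ψ_{k+l}^{s,q} = Ψ_k^{s,q}·Ψ_l^{s,q} if s = τ_1(q)+τ_2(q); and Ψ_{k+l}^{s,q} ≥ Ψ_k^{s,q}·Ψ_l^{s,q} if s > τ_1(q)+τ_2(q). -/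
open MeasureTheory Filter Set

attribute [local instance] Classical.propDecidable

noncomputable section

/-- Data of a box-like planar self-affine IFS: each map is `S i = T i ∘ L i + t i`, where
`T i` is the diagonal contraction `diag (c i, d i)` with `c i, d i ∈ (0,1)` and `L i` is a
linear isometry of the plane preserving `[-1,1]²`, i.e. one of the eight symmetries of the
square, encoded by whether it swaps the two axes (`swap`) and by a sign on each coordinate. -/
structure IFSData (ι : Type) where
  c : ι → ℝ
  d : ι → ℝ
  swap : ι → Bool
  sgn1 : ι → Bool
  sgn2 : ι → Bool
  t : ι → ℝ × ℝ

namespace IFSData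

variable {ι : Type}

/-- The affine contraction `S i = T i ∘ L i + t i`. -/
def S (B : IFSData ι) (i : ι) (x : ℝ × ℝ) : ℝ × ℝ :=
  ((if B.sgn1 i then 1 else -1) * (B.c i * (if B.swap i then x.2 else x.1)) + (B.t i).1,
   (if B.sgn2 i then 1 else -1) * (B.d i * (if B.swap i then x.1 else x.2)) + (B.t i).2)

/-- `(b(i), h(i))`: base and height of the rectangle `S_i([0,1]²)` for a finite word `i`. -/
def dims (B : IFSData ι) (l : List ι) : ℝ × ℝ :=
  l.foldr (fun i w =>
    (B.c i * (if B.swap i then w.2 else w.1), B.d i * (if B.swap i then w.1 else w.2))) (1, 1)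

/-- `α₁(i)`: the larger singular value of the linear part of `S_i`. -/
def alpha1 (B : IFSData ι) (l : List ι) : ℝ := max (B.dims l).1 (B.dims l).2

/-- `α₂(i)`: the smaller singular value of the linear part of `S_i`. -/
def alpha2 (B : IFSData ι) (l : List ι) : ℝ := min (B.dims l).1 (B.dims l).2

/-- Whether the composite map of the word maps horizontal lines to vertical lines. -/
def swapW (B : IFSData ι) (l : List ι) : Bool := l.foldr (fun i b => xor (B.swap i) b) false

/-- The composite map `S_{i₁} ∘ ⋯ ∘ S_{i_k}` of a word. -/
def Sw (B : IFSData ι) (l : List ι) : ℝ × ℝ → ℝ × ℝ := l.foldr (fun i f => B.S i ∘ f) id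

/-- The word `i` projects onto the first coordinate, i.e. `π_i = π₁`. -/
def usesPi1 (B : IFSData ι) (l : List ι) : Prop :=
  (B.swapW l = false ∧ (B.dims l).2 ≤ (B.dims l).1) ∨
    (B.swapW l = true ∧ (B.dims l).1 < (B.dims l).2)

/-- The projection `π_i` onto the direction of the longest side of `S_i([0,1]²)`. -/
def projW (B : IFSData ι) (l : List ι) : ℝ × ℝ → ℝ :=
  if B.usesPi1 l then Prod.fst else Prod.snd

/-- The rectangular open set condition. -/
def ROSC (B : IFSData ι) : Prop :=
  ∃ x₁ x₂ y₁ y₂ : ℝ, x₁ < x₂ ∧ y₁ < y₂ ∧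
    (∀ i, B.S i '' (Set.Ioo x₁ x₂ ×ˢ Set.Ioo y₁ y₂) ⊆ Set.Ioo x₁ x₂ ×ˢ Set.Ioo y₁ y₂) ∧
    Pairwise fun i j =>
      Disjoint (B.S i '' (Set.Ioo x₁ x₂ ×ˢ Set.Ioo y₁ y₂))
        (B.S j '' (Set.Ioo x₁ x₂ ×ˢ Set.Ioo y₁ y₂))

end IFSData

/-- `p(i)`: the probability of a finite word. -/
def wordProb {ι : Type} (p : ι → ℝ) (l : List ι) : ℝ := (l.map p).prod

/-- `τ_i(q)`: the value of the `L^q`-spectrum of the projection `π_i μ`. -/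
def tauW {ι : Type} (B : IFSData ι) (τ1 τ2 : ℝ → ℝ) (l : List ι) (q : ℝ) : ℝ :=
  if B.usesPi1 l then τ1 q else τ2 q

/-- The `q`-modified singular value function `ψ^{s,q}`. -/
def psiSV {ι : Type} (B : IFSData ι) (p : ι → ℝ) (τ1 τ2 : ℝ → ℝ) (s q : ℝ) (l : List ι) : ℝ :=
  wordProb p l ^ q * B.alpha1 l ^ tauW B τ1 τ2 l q * B.alpha2 l ^ (s - tauW B τ1 τ2 l q)

/-- `Ψ_k^{s,q} = ∑_{i ∈ I^k} ψ^{s,q}(i)`. -/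
def PsiSV {ι : Type} [Fintype ι] (B : IFSData ι) (p : ι → ℝ) (τ1 τ2 : ℝ → ℝ)
    (k : ℕ) (s q : ℝ) : ℝ :=
  ∑ f : Fin k → ι, psiSV B p τ1 τ2 s q (List.ofFn f)

/-- The `L^q`-spectrum of `ν` exists and equals `t`. -/
def IsLqSpec {X : Type*} [MeasurableSpace X] [PseudoMetricSpace X]
    (ν : Measure X) (q t : ℝ) : Prop :=
  lowerLq ν q = t ∧ upperLq ν q = t

/-- `α_min = min_{i ∈ I} α₂(i)`. -/
def alphaMin {ι : Type} [Fintype ι] [Nonempty ι] (B : IFSData ι) : ℝ :=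
  Finset.univ.inf' Finset.univ_nonempty fun i => min (B.c i) (B.d i)

/-- `α_max = max_{i ∈ I} α₁(i)`. -/
def alphaMax {ι : Type} [Fintype ι] [Nonempty ι] (B : IFSData ι) : ℝ :=
  Finset.univ.sup' Finset.univ_nonempty fun i => max (B.c i) (B.d i)

/-- `p_max = max_{i ∈ I} p_i`. -/
def pMax {ι : Type} [Fintype ι] [Nonempty ι] (p : ι → ℝ) : ℝ :=
  Finset.univ.sup' Finset.univ_nonempty p

/-- The `δ`-stopping `I_δ`. -/
def stopping {ι : Type} (B : IFSData ι) (δ : ℝ) : Set (List ι) :=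
  {l | l ≠ [] ∧ B.alpha2 l < δ ∧ δ ≤ B.alpha2 l.dropLast}

namespace SVAux
variable {ι : Type}

lemma dims_append (B : IFSData ι) (i j : List ι) : B.dims (i ++ j) =
    ((B.dims i).1 * (if B.swapW i then (B.dims j).2 else (B.dims j).1),
     (B.dims i).2 * (if B.swapW i then (B.dims j).1 else (B.dims j).2)) := by
  induction i with
  | nil => simp [IFSData.dims, IFSData.swapW]
  | cons a i ih =>
    have e1 : ∀ l, B.dims (a :: l) = (B.c a * (if B.swap a then (B.dims l).2 else (B.dims l).1),
      B.d a * (if B.swap a then (B.dims l).1 else (B.dims l).2)) := fun l => rfl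
    have e2 : B.swapW (a :: i) = xor (B.swap a) (B.swapW i) := rfl
    rw [List.cons_append, e1, e1, e2, ih]
    cases B.swap a <;> cases B.swapW i <;> simp [mul_assoc]

lemma dims_pos (B : IFSData ι) (hc : ∀ i, 0 < B.c i) (hd : ∀ i, 0 < B.d i) (l : List ι) :
    0 < (B.dims l).1 ∧ 0 < (B.dims l).2 := by
  induction l with
  | nil => simp [IFSData.dims]
  | cons a i ih =>
    have e1 : B.dims (a :: i) = (B.c a * (if B.swap a then (B.dims i).2 else (B.dims i).1),
      B.d a * (if B.swap a then (B.dims i).1 else (B.dims i).2)) := rfl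
    rw [e1]
    have := hc a
    have := hd a
    obtain ⟨h1, h2⟩ := ih
    cases B.swap a <;> constructor <;> simp <;> positivity

lemma swapW_false (B : IFSData ι) (h : ∀ i, B.swap i = false) (l : List ι) :
    B.swapW l = false := by
  induction l with
  | nil => rfl
  | cons a i ih =>
    have e2 : B.swapW (a :: i) = xor (B.swap a) (B.swapW i) := rfl
    rw [e2, ih, h]; rfl

lemma wordProb_pos (p : ι → ℝ) (hp : ∀ i, 0 < p i) (l : List ι) : 0 < wordProb p l := by
  unfold wordProb
  apply List.prod_pos
  intro a ha
  obtain ⟨i, -, rfl⟩ := List.mem_map.1 ha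
  exact hp i

lemma alpha2_append (B : IFSData ι) (hc : ∀ i, 0 < B.c i) (hd : ∀ i, 0 < B.d i) (i j : List ι) :
    B.alpha2 i * B.alpha2 j ≤ B.alpha2 (i ++ j) := by
  obtain ⟨h1, h2⟩ := dims_pos B hc hd i
  obtain ⟨h3, h4⟩ := dims_pos B hc hd j
  unfold IFSData.alpha2
  rw [dims_append]
  have h5 : 0 < min (B.dims j).1 (B.dims j).2 := lt_min h3 h4
  apply le_min <;> apply mul_le_mul _ _ h5.le (by positivity)
  · exact min_le_left _ _
  · split_ifs
    exacts [min_le_right _ _, min_le_left _ _]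
  · exact min_le_right _ _
  · split_ifs
    exacts [min_le_left _ _, min_le_right _ _]

lemma psi_form (B : IFSData ι) (hc : ∀ i, 0 < B.c i) (hd : ∀ i, 0 < B.d i)
    (p : ι → ℝ) (τ1 τ2 : ℝ → ℝ) (q s : ℝ)
    (h : (∀ i, B.swap i = false) ∨ τ1 q = τ2 q) (l : List ι) :
    psiSV B p τ1 τ2 s q l = (wordProb p l ^ q * ((B.dims l).1 ^ τ1 q * (B.dims l).2 ^ τ2 q)) *
      B.alpha2 l ^ (s - (τ1 q + τ2 q)) := by
  obtain ⟨h1, h2⟩ := dims_pos B hc hd l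
  have key : ∀ x y a b : ℝ, 0 < y → x ^ a * y ^ (s - a) = x ^ a * y ^ b * y ^ (s - (a + b)) := by
    intro x y a b hy
    rw [mul_assoc, ← Real.rpow_add hy]; congr 2; ring
  unfold psiSV tauW IFSData.usesPi1 IFSData.alpha1 IFSData.alpha2
  rw [mul_assoc, mul_assoc (wordProb p l ^ q)]
  congr 1
  rcases h with h | h
  · simp only [swapW_false B h l]
    rcases le_or_gt (B.dims l).2 (B.dims l).1 with h3 | h3
    · simp only [h3, max_eq_left, min_eq_right]
      simpa using key _ _ _ _ h2
    · simp only [h3.le, max_eq_right, min_eq_left, not_le.2 h3]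
      simp
      rw [key _ _ _ (τ1 q) h1, add_comm (τ2 q)]; ring
  · rw [h, ite_self]
    rcases le_or_gt (B.dims l).2 (B.dims l).1 with h3 | h3
    · simp only [h3, max_eq_left, min_eq_right]
      simpa using key _ _ _ _ h2
    · simp only [h3.le, max_eq_right, min_eq_left]
      rw [key _ _ _ (τ2 q) h1]; ring

lemma G_append (B : IFSData ι) (hc : ∀ i, 0 < B.c i) (hd : ∀ i, 0 < B.d i)
    (p : ι → ℝ) (hp : ∀ i, 0 < p i) (q a b : ℝ)
    (h : (∀ i, B.swap i = false) ∨ a = b) (i j : List ι) :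
    (wordProb p (i ++ j) ^ q * ((B.dims (i ++ j)).1 ^ a * (B.dims (i ++ j)).2 ^ b)) =
    (wordProb p i ^ q * ((B.dims i).1 ^ a * (B.dims i).2 ^ b)) *
    (wordProb p j ^ q * ((B.dims j).1 ^ a * (B.dims j).2 ^ b)) := by
  obtain ⟨h1, h2⟩ := dims_pos B hc hd i
  obtain ⟨h3, h4⟩ := dims_pos B hc hd j
  have e : wordProb p (i ++ j) = wordProb p i * wordProb p j := by simp [wordProb]
  rw [e, Real.mul_rpow (wordProb_pos p hp i).le (wordProb_pos p hp j).le, dims_append]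
  rcases h with h | h
  · simp only [swapW_false B h]
    simp
    rw [Real.mul_rpow h1.le h3.le, Real.mul_rpow h2.le h4.le]; ring
  · subst h
    cases B.swapW i <;> simp
    · rw [Real.mul_rpow h1.le h3.le, Real.mul_rpow h2.le h4.le]; ring
    · rw [Real.mul_rpow h1.le h4.le, Real.mul_rpow h2.le h3.le]; ring

lemma psi_mult (B : IFSData ι) (hc : ∀ i, 0 < B.c i) (hd : ∀ i, 0 < B.d i)
    (p : ι → ℝ) (hp : ∀ i, 0 < p i) (τ1 τ2 : ℝ → ℝ) (q s : ℝ)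
    (h : (∀ i, B.swap i = false) ∨ τ1 q = τ2 q) (i j : List ι) :
    ((s < τ1 q + τ2 q →
        psiSV B p τ1 τ2 s q (i ++ j) ≤ psiSV B p τ1 τ2 s q i * psiSV B p τ1 τ2 s q j) ∧
     (s = τ1 q + τ2 q →
        psiSV B p τ1 τ2 s q (i ++ j) = psiSV B p τ1 τ2 s q i * psiSV B p τ1 τ2 s q j) ∧
     (τ1 q + τ2 q < s →
        psiSV B p τ1 τ2 s q i * psiSV B p τ1 τ2 s q j ≤ psiSV B p τ1 τ2 s q (i ++ j))) := by
  have hG : ∀ l, 0 < (wordProb p l ^ q * ((B.dims l).1 ^ τ1 q * (B.dims l).2 ^ τ2 q)) := by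
    intro l
    obtain ⟨h1, h2⟩ := dims_pos B hc hd l
    have := wordProb_pos p hp l
    positivity
  have ha : ∀ l, 0 < B.alpha2 l := fun l => lt_min (dims_pos B hc hd l).1 (dims_pos B hc hd l).2
  have hm := alpha2_append B hc hd i j
  simp only [psi_form B hc hd p τ1 τ2 q s h]
  rw [G_append B hc hd p hp q _ _ h]
  have hR : ∀ x y : ℝ, x * B.alpha2 i ^ (s - (τ1 q + τ2 q)) * (y * B.alpha2 j ^ (s - (τ1 q + τ2 q)))
      = x * y * (B.alpha2 i * B.alpha2 j) ^ (s - (τ1 q + τ2 q)) := by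
    intro x y
    rw [Real.mul_rpow (ha i).le (ha j).le]; ring
  rw [hR]
  have hij := mul_pos (hG i) (hG j)
  refine ⟨fun hs => ?_, fun hs => ?_, fun hs => ?_⟩
  · exact mul_le_mul_of_nonneg_left
      (Real.rpow_le_rpow_of_nonpos (mul_pos (ha i) (ha j)) hm (by linarith)) hij.le
  · rw [hs]; simp
  · exact mul_le_mul_of_nonneg_left
      (Real.rpow_le_rpow (mul_pos (ha i) (ha j)).le hm (by linarith)) hij.le

lemma Psi_add [Fintype ι] (B : IFSData ι) (p : ι → ℝ) (τ1 τ2 : ℝ → ℝ) (k l : ℕ) (s q : ℝ) :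
    PsiSV B p τ1 τ2 (k + l) s q = ∑ x : (Fin k → ι) × (Fin l → ι),
      psiSV B p τ1 τ2 s q (List.ofFn x.1 ++ List.ofFn x.2) := by
  unfold PsiSV
  rw [← (Fin.appendEquiv k l).sum_comp]
  apply Finset.sum_congr rfl
  intro x _
  rw [← List.ofFn_fin_append]
  rfl

lemma Psi_mul [Fintype ι] (B : IFSData ι) (p : ι → ℝ) (τ1 τ2 : ℝ → ℝ) (k l : ℕ) (s q : ℝ) :
    PsiSV B p τ1 τ2 k s q * PsiSV B p τ1 τ2 l s q = ∑ x : (Fin k → ι) × (Fin l → ι),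
      psiSV B p τ1 τ2 s q (List.ofFn x.1) * psiSV B p τ1 τ2 s q (List.ofFn x.2) := by
  unfold PsiSV
  rw [Fintype.sum_mul_sum, Fintype.sum_prod_type]
lemma rpow_anti {a b : ENNReal} {z : ℝ} (hz : z ≤ 0) (h : a ≤ b) : b ^ z ≤ a ^ z := by
  have := ENNReal.rpow_le_rpow h (neg_nonneg.2 hz)
  rw [ENNReal.rpow_neg, ENNReal.rpow_neg] at this
  exact ENNReal.inv_le_inv.1 this

/-- The integral defining the `L^q` spectrum, as a lower Lebesgue integral. -/
def J (ν : Measure ℝ) (q δ : ℝ) : ENNReal := ∫⁻ x, (ν (Metric.ball x δ)) ^ (q - 1) ∂ν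

/-- Uniform polynomial lower bound on the masses of balls. -/
def MassBd (ν : Measure ℝ) (C : ℝ) : Prop :=
  ∀ᶠ δ in nhdsWithin (0:ℝ) (Set.Ioi 0), ∀ᵐ x ∂ν, ENNReal.ofReal (δ ^ C) ≤ ν (Metric.ball x δ)

lemma meas_ball {X : Type*} [MeasurableSpace X] [PseudoMetricSpace X] [BorelSpace X]
    [SecondCountableTopology X] (ν : Measure X) [SFinite ν] (δ : ℝ) :
    Measurable fun x => ν (Metric.ball x δ) := by
  have hs : MeasurableSet {p : X × X | dist p.1 p.2 < δ} :=
    measurableSet_lt measurable_dist measurable_const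
  convert measurable_measure_prodMk_left (ν := ν) hs using 3
  ext y
  simp [dist_comm]

/-- Mass bound at geometric scales. -/
lemma mass_geom [Fintype ι] (B : IFSData ι)
    (p : ι → ℝ) (μ : Measure (ℝ × ℝ)) [IsProbabilityMeasure μ]
    (hcpt : ∃ K : Set (ℝ × ℝ), IsCompact K ∧ μ Kᶜ = 0)
    (hself : μ = ∑ i : ι, ENNReal.ofReal (p i) • Measure.map (B.S i) μ)
    (hm : ∀ i, Measurable (B.S i))
    (r m : ℝ) (hm0 : 0 ≤ m) (hmp : ∀ i, m ≤ p i)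
    (hr : ∀ i x y, dist (B.S i x) (B.S i y) ≤ r * dist x y) (hr0 : 0 ≤ r) :
    ∃ D : ℝ, 0 < D ∧ ∀ n : ℕ, ∀ᵐ x ∂μ,
      ENNReal.ofReal (m ^ n) ≤ μ (Metric.closedBall x (r ^ n * D)) := by
  obtain ⟨K, hK, hK0⟩ := hcpt
  obtain ⟨D, hD⟩ := Metric.isBounded_iff.1 hK.isBounded
  refine ⟨max D 1, by positivity, fun n => ?_⟩
  induction n with
  | zero =>
    have : ∀ᵐ x ∂μ, x ∈ K := hK0
    filter_upwards [this] with x hx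
    have h1 : μ K = 1 := (prob_compl_eq_zero_iff hK.measurableSet).1 hK0
    simp only [pow_zero, ENNReal.ofReal_one, one_mul]
    rw [← h1]
    apply measure_mono
    intro y hy
    exact (hD hy hx).trans (le_max_left _ _)
  | succ n ih =>
    have hS : MeasurableSet {x | ENNReal.ofReal (m ^ (n+1)) ≤
        μ (Metric.closedBall x (r ^ (n+1) * max D 1))} := by
      have hs : MeasurableSet {p : (ℝ × ℝ) × (ℝ × ℝ) | dist p.1 p.2 ≤ r ^ (n+1) * max D 1} :=
        measurableSet_le measurable_dist measurable_const
      apply measurableSet_le measurable_const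
      convert measurable_measure_prodMk_left (ν := μ) hs using 3
      ext y
      simp [dist_comm]
    have key : ∀ i, ∀ᵐ x ∂(Measure.map (B.S i) μ), ENNReal.ofReal (m ^ (n+1)) ≤
        μ (Metric.closedBall x (r ^ (n+1) * max D 1)) := by
      intro i
      rw [ae_map_iff (hm i).aemeasurable hS]
      filter_upwards [ih] with y hy
      have h1 : ENNReal.ofReal (p i) • Measure.map (B.S i) μ ≤ μ := by
        conv_rhs => rw [hself]
        exact Finset.single_le_sum (f := fun i => ENNReal.ofReal (p i) • Measure.map (B.S i) μ)
          (fun _ _ => Measure.zero_le _) (Finset.mem_univ i)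
      refine le_trans ?_ (h1 _)
      rw [Measure.smul_apply, Measure.map_apply (hm i) Metric.isClosed_closedBall.measurableSet,
        smul_eq_mul, pow_succ', ENNReal.ofReal_mul hm0]
      apply mul_le_mul' (ENNReal.ofReal_le_ofReal (hmp i))
      refine hy.trans (measure_mono ?_)
      intro z hz
      simp only [Metric.mem_closedBall, Set.mem_preimage] at hz ⊢
      calc _ ≤ r * dist z y := hr i z y
        _ ≤ r * (r ^ n * max D 1) := mul_le_mul_of_nonneg_left hz hr0
        _ = _ := by ring
    have h2 : ∀ᵐ x ∂(∑ i : ι, ENNReal.ofReal (p i) • Measure.map (B.S i) μ),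
        ENNReal.ofReal (m ^ (n+1)) ≤ μ (Metric.closedBall x (r ^ (n+1) * max D 1)) := by
      rw [ae_iff, Measure.finsetSum_apply]
      apply Finset.sum_eq_zero
      intro i _
      rw [Measure.smul_apply, ae_iff.1 (key i), smul_zero]
    rw [← hself] at h2
    exact h2

lemma mass_ball (μ : Measure (ℝ × ℝ)) (r m D : ℝ) (hr0 : 0 < r) (hr1 : r < 1) (hm0 : 0 < m)
    (hm1 : m < 1) (hD : 0 < D)
    (h : ∀ n : ℕ, ∀ᵐ x ∂μ, ENNReal.ofReal (m ^ n) ≤ μ (Metric.closedBall x (r ^ n * D))) :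
    ∃ C : ℝ, 0 < C ∧ ∀ᶠ δ in nhdsWithin (0:ℝ) (Set.Ioi 0), ∀ᵐ x ∂μ,
      ENNReal.ofReal (δ ^ C) ≤ μ (Metric.ball x δ) := by
  have hlr : Real.log r < 0 := Real.log_neg hr0 hr1
  have hlm : Real.log m < 0 := Real.log_neg hm0 hm1
  have hc' : 0 < Real.log m / Real.log r := div_pos_of_neg_of_neg hlm hlr
  set c' := Real.log m / Real.log r
  refine ⟨2 * c', by positivity, ?_⟩
  have hrc : r ^ c' = m := by
    rw [Real.rpow_def_of_pos hr0, mul_div_cancel₀ _ hlr.ne, Real.exp_log hm0]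
  have hpos : (0:ℝ) < min D (r / D) := by positivity
  filter_upwards [Ioo_mem_nhdsGT hpos] with δ hδ
  obtain ⟨hδ0, hδ1⟩ := hδ
  have hδD : δ < D := hδ1.trans_le (min_le_left _ _)
  have hδr : δ < r / D := hδ1.trans_le (min_le_right _ _)
  have hex : ∃ n : ℕ, r ^ n * D < δ := by
    obtain ⟨n, hn⟩ := exists_pow_lt_of_lt_one (div_pos hδ0 hD) hr1
    exact ⟨n, (lt_div_iff₀ hD).1 hn⟩
  have hsp := Nat.find_spec hex
  have hmin := fun k => Nat.find_min hex (m := k)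
  set n := Nat.find hex
  have hn : n ≠ 0 := by
    intro h0
    rw [h0] at hsp
    simp at hsp
    linarith
  obtain ⟨k, hk⟩ := Nat.exists_eq_succ_of_ne_zero hn
  have h1 : δ ≤ r ^ k * D := not_lt.1 (hmin k (by omega))
  filter_upwards [h n] with x hx
  refine le_trans (le_trans (ENNReal.ofReal_le_ofReal ?_) hx)
    (measure_mono (Metric.closedBall_subset_ball hsp))
  have h2 : δ ^ 2 ≤ r ^ n := by
    rw [hk, pow_succ]
    have h3 : δ * D ≤ r := ((lt_div_iff₀ hD).1 hδr).le
    have h4 : δ * (δ * D) ≤ (r ^ k * D) * r := mul_le_mul h1 h3 (by positivity) (by positivity)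
    have : δ ^ 2 * D ≤ r ^ k * r * D := by linarith [h4]
    exact le_of_mul_le_mul_right this hD
  rw [Real.rpow_mul hδ0.le, ← hrc, ← Real.rpow_natCast, ← Real.rpow_mul hr0.le, mul_comm c',
    Real.rpow_mul hr0.le, Real.rpow_natCast]
  apply Real.rpow_le_rpow (by positivity) _ hc'.le
  exact_mod_cast h2

lemma mass_proj (μ : Measure (ℝ × ℝ)) [IsProbabilityMeasure μ] (f : ℝ × ℝ → ℝ)
    (hf : Measurable f) (hL : ∀ x y, dist (f x) (f y) ≤ dist x y) (C : ℝ)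
    (h : ∀ᶠ δ in nhdsWithin (0:ℝ) (Set.Ioi 0), ∀ᵐ x ∂μ,
      ENNReal.ofReal (δ ^ C) ≤ μ (Metric.ball x δ)) : MassBd (Measure.map f μ) C := by
  filter_upwards [h] with δ hδ
  have := Measure.isProbabilityMeasure_map (μ := μ) hf.aemeasurable
  rw [ae_map_iff hf.aemeasurable (measurableSet_le measurable_const (meas_ball _ δ))]
  filter_upwards [hδ] with x hx
  rw [Measure.map_apply hf Metric.isOpen_ball.measurableSet]
  refine hx.trans (measure_mono fun y hy => ?_)
  exact (hL y x).trans_lt hy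

/-- Bounds on `J`, plus identification with the Bochner integral. -/
lemma J_bounds (ν : Measure ℝ) [IsProbabilityMeasure ν] (C q δ : ℝ) (hδ : 0 < δ)
    (hC : ∀ᵐ x ∂ν, ENNReal.ofReal (δ ^ C) ≤ ν (Metric.ball x δ)) :
    J ν q δ ≠ ⊤ ∧ J ν q δ ≠ 0 ∧
    (∫ x, (ν (Metric.ball x δ)).toReal ^ (q - 1) ∂ν) = (J ν q δ).toReal ∧
    |Real.log (J ν q δ).toReal| ≤ |C * (q - 1) * Real.log δ| := by
  have hc0 : 0 < δ ^ C := Real.rpow_pos_of_pos hδ C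
  have hc : ENNReal.ofReal (δ ^ C) ^ (q - 1) = ENNReal.ofReal (δ ^ (C * (q - 1))) := by
    rw [ENNReal.ofReal_rpow_of_pos hc0, ← Real.rpow_mul hδ.le]
  have hd0 : 0 < δ ^ (C * (q - 1)) := Real.rpow_pos_of_pos hδ _
  have hlog : Real.log (δ ^ (C * (q - 1))) = C * (q - 1) * Real.log δ := Real.log_rpow hδ _
  set d := δ ^ (C * (q - 1))
  have hmeas : Measurable fun x => (ν (Metric.ball x δ)) ^ (q - 1) :=
    (meas_ball ν δ).pow_const _
  have hBoch : J ν q δ ≠ ⊤ → (∫ x, (ν (Metric.ball x δ)).toReal ^ (q - 1) ∂ν)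
      = (J ν q δ).toReal := by
    intro hf
    unfold J at hf ⊢
    rw [← integral_toReal hmeas.aemeasurable (ae_lt_top hmeas hf)]
    simp only [ENNReal.toReal_rpow]
  rcases le_or_gt 1 q with hq | hq
  · have hu : J ν q δ ≤ 1 := by
      calc J ν q δ ≤ ∫⁻ x, 1 ∂ν := by
            apply lintegral_mono
            intro x
            exact ENNReal.rpow_le_one prob_le_one (by linarith)
        _ = 1 := by simp
    have hl : ENNReal.ofReal d ≤ J ν q δ := by
      calc ENNReal.ofReal d = ∫⁻ x, ENNReal.ofReal d ∂ν := by simp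
        _ ≤ J ν q δ := by
            apply lintegral_mono_ae
            filter_upwards [hC] with x hx
            rw [← hc]
            exact ENNReal.rpow_le_rpow hx (by linarith)
    have hf : J ν q δ ≠ ⊤ := (hu.trans_lt ENNReal.one_lt_top).ne
    have hl' : d ≤ (J ν q δ).toReal := (ENNReal.ofReal_le_iff_le_toReal hf).1 hl
    have hu' : (J ν q δ).toReal ≤ 1 := by
      simpa using ENNReal.toReal_mono ENNReal.one_ne_top hu
    refine ⟨hf, ?_, hBoch hf, ?_⟩
    · intro h0
      rw [h0] at hl'
      simp at hl'; linarith
    · have h1 : Real.log (J ν q δ).toReal ≤ 0 := Real.log_nonpos (by simp) hu'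
      have h2 := Real.log_le_log hd0 hl'
      rw [abs_of_nonpos h1, ← hlog]
      exact (neg_le_neg h2).trans (neg_le_abs _)
  · have hu : 1 ≤ J ν q δ := by
      calc (1:ENNReal) = ∫⁻ x, 1 ∂ν := by simp
        _ ≤ J ν q δ := by
            apply lintegral_mono
            intro x
            have := rpow_anti (z := q - 1) (by linarith) (prob_le_one (μ := ν) (s := Metric.ball x δ))
            simpa using this
    have hl : J ν q δ ≤ ENNReal.ofReal d := by
      calc J ν q δ ≤ ∫⁻ x, ENNReal.ofReal d ∂ν := by
            apply lintegral_mono_ae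
            filter_upwards [hC] with x hx
            rw [← hc]
            exact rpow_anti (by linarith) hx
        _ = ENNReal.ofReal d := by simp
    have hf : J ν q δ ≠ ⊤ := (hl.trans_lt ENNReal.ofReal_lt_top).ne
    have hl' : (J ν q δ).toReal ≤ d := ENNReal.toReal_le_of_le_ofReal hd0.le hl
    have hu' : 1 ≤ (J ν q δ).toReal := by
      simpa using ENNReal.toReal_mono hf hu
    refine ⟨hf, ?_, hBoch hf, ?_⟩
    · intro h0
      rw [h0] at hu
      simp at hu
    · have h1 : 0 ≤ Real.log (J ν q δ).toReal := Real.log_nonneg hu'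
      have h2 := Real.log_le_log (by linarith) hl'
      rw [abs_of_nonneg h1, ← hlog]
      exact h2.trans (le_abs_self _)

lemma spec_tendsto (ν : Measure ℝ) [IsProbabilityMeasure ν] (C q t : ℝ)
    (hC : MassBd ν C) (h : IsLqSpec ν q t) :
    Tendsto (fun δ : ℝ => Real.log (J ν q δ).toReal / (-Real.log δ))
      (nhdsWithin 0 (Set.Ioi 0)) (nhds t) := by
  have hev : ∀ᶠ δ in nhdsWithin (0:ℝ) (Set.Ioi 0), δ ∈ Set.Ioo (0:ℝ) 1 :=
    Ioo_mem_nhdsGT one_pos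
  have heq : (fun δ : ℝ => Real.log (∫ x, (ν (Metric.ball x δ)).toReal ^ (q - 1) ∂ν)
      / (-Real.log δ)) =ᶠ[nhdsWithin 0 (Set.Ioi 0)]
      (fun δ : ℝ => Real.log (J ν q δ).toReal / (-Real.log δ)) := by
    filter_upwards [hC, hev] with δ h1 h2
    rw [(J_bounds ν C q δ h2.1 h1).2.2.1]
  have hb : ∀ᶠ δ in nhdsWithin (0:ℝ) (Set.Ioi 0),
      |Real.log (J ν q δ).toReal / (-Real.log δ)| ≤ |C * (q - 1)| := by
    filter_upwards [hC, hev] with δ h1 h2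
    have hl : Real.log δ < 0 := Real.log_neg h2.1 h2.2
    have := (J_bounds ν C q δ h2.1 h1).2.2.2
    rw [abs_div, abs_neg, div_le_iff₀ (abs_pos.2 hl.ne), ← abs_mul]
    exact this
  obtain ⟨h1, h2⟩ := h
  unfold lowerLq at h1
  unfold upperLq at h2
  rw [liminf_congr heq] at h1
  rw [limsup_congr heq] at h2
  refine tendsto_of_liminf_eq_limsup h1 h2 ?_ ?_
  · exact ⟨|C * (q - 1)|, by
      rw [eventually_map]; filter_upwards [hb] with δ h using (abs_le.1 h).2⟩
  · exact ⟨-|C * (q - 1)|, by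
      rw [eventually_map]; filter_upwards [hb] with δ h using (abs_le.1 h).1⟩
/-- Change of variables for `J` under an affine map. -/
lemma J_affine (ν : Measure ℝ) [IsProbabilityMeasure ν] (a t q δ : ℝ) (ha : a ≠ 0) :
    J (Measure.map (fun x => a * x + t) ν) q δ = J ν q (δ / |a|) := by
  have hm : Measurable fun x : ℝ => a * x + t := by fun_prop
  have : IsProbabilityMeasure (Measure.map (fun x => a * x + t) ν) :=
    Measure.isProbabilityMeasure_map hm.aemeasurable
  unfold J
  rw [lintegral_map ((meas_ball _ δ).pow_const _) hm]
  congr 1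
  ext x
  rw [Measure.map_apply hm Metric.isOpen_ball.measurableSet]
  congr 2
  ext y
  simp only [Set.mem_preimage, Metric.mem_ball, Real.dist_eq]
  rw [lt_div_iff₀ (abs_pos.2 ha), ← abs_mul]
  congr! 2
  ring

/-- Comparison in the range `q ≥ 1`. -/
lemma J_ge_one (ν ρ : Measure ℝ) (P : ENNReal) (hle : P • ρ ≤ ν) (q δ : ℝ)
    (hP : P ≠ 0) (hPt : P ≠ ⊤) [IsProbabilityMeasure ρ]
    (hq : 1 ≤ q) : P ^ q * J ρ q δ ≤ J ν q δ := by
  have h0 : P ^ q = P * P ^ (q - 1) := by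
    conv_rhs => rw [← ENNReal.rpow_one P, ← ENNReal.rpow_mul, one_mul, ← ENNReal.rpow_add _ _ hP hPt]
    congr 1; ring
  unfold J
  calc P ^ q * ∫⁻ x, ρ (Metric.ball x δ) ^ (q - 1) ∂ρ
      = P * ∫⁻ x, (P * ρ (Metric.ball x δ)) ^ (q - 1) ∂ρ := by
        simp_rw [ENNReal.mul_rpow_of_nonneg _ _ (sub_nonneg.2 hq)]
        rw [lintegral_const_mul _ ((meas_ball ρ δ).pow_const _), h0, mul_assoc]
    _ = ∫⁻ x, (P * ρ (Metric.ball x δ)) ^ (q - 1) ∂(P • ρ) := by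
        rw [lintegral_smul_measure, smul_eq_mul]
    _ ≤ ∫⁻ x, (ν (Metric.ball x δ)) ^ (q - 1) ∂ν := by
        apply lintegral_mono' hle
        intro x
        apply ENNReal.rpow_le_rpow _ (sub_nonneg.2 hq)
        simpa using hle (Metric.ball x δ)

/-- Covering bound. -/
lemma cover (ρ : Measure ℝ) [IsProbabilityMeasure ρ] (η : ℝ) (hη : 0 < η) (L : ℕ) (y : ℝ) :
    ∫⁻ x in Metric.ball y (L * η), (ρ (Metric.ball x η))⁻¹ ∂ρ ≤ 2 * L := by
  let A : Fin (2 * L) → Set ℝ := fun m => Set.Ico (y - L * η + m * η) (y - L * η + (m + 1) * η)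
  have hsub : Metric.ball y (L * η) ⊆ ⋃ m, A m := by
    intro x hx
    rw [Metric.mem_ball, Real.dist_eq, abs_lt] at hx
    have h0 : 0 ≤ (x - (y - L * η)) / η := by
      apply div_nonneg _ hη.le
      linarith
    have h1 : (x - (y - L * η)) / η < 2 * L := by
      rw [div_lt_iff₀ hη]
      linarith
    have h2 := Nat.floor_le h0
    have h3 := Nat.lt_floor_add_one ((x - (y - L * η)) / η)
    have h4 : ⌊(x - (y - L * η)) / η⌋₊ < 2 * L := by
      rw [Nat.floor_lt h0]; exact_mod_cast h1
    rw [Set.mem_iUnion]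
    refine ⟨⟨_, h4⟩, ?_, ?_⟩
    · rw [le_div_iff₀ hη] at h2
      dsimp; linarith
    · rw [div_lt_iff₀ hη] at h3
      dsimp; linarith
  have hA : ∀ m, ∫⁻ x in A m, (ρ (Metric.ball x η))⁻¹ ∂ρ ≤ 1 := by
    intro m
    calc ∫⁻ x in A m, (ρ (Metric.ball x η))⁻¹ ∂ρ ≤ ∫⁻ x in A m, (ρ (A m))⁻¹ ∂ρ := by
          apply setLIntegral_mono' measurableSet_Ico
          intro x hx
          apply ENNReal.inv_le_inv.2
          apply measure_mono
          intro z hz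
          have hx1 := hx.1
          have hx2 := hx.2
          have hz1 := hz.1
          have hz2 := hz.2
          rw [Metric.mem_ball, Real.dist_eq, abs_lt]
          constructor <;> linarith
      _ = (ρ (A m))⁻¹ * ρ (A m) := by rw [setLIntegral_const]
      _ ≤ 1 := ENNReal.inv_mul_le_one _
  calc ∫⁻ x in Metric.ball y (L * η), (ρ (Metric.ball x η))⁻¹ ∂ρ
      ≤ ∫⁻ x in ⋃ m, A m, (ρ (Metric.ball x η))⁻¹ ∂ρ := lintegral_mono_set hsub
    _ ≤ ∑' m, ∫⁻ x in A m, (ρ (Metric.ball x η))⁻¹ ∂ρ := lintegral_iUnion_le _ _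
    _ ≤ ∑' m : Fin (2 * L), 1 := ENNReal.tsum_le_tsum hA
    _ = 2 * L := by simp

/-- Local lower bound obtained by pigeonholing over `L` scales. -/
lemma pigeon (ν : Measure ℝ) [IsProbabilityMeasure ν] (C q η : ℝ) (hη : 0 < η)
    (hq0 : 0 ≤ q) (hq : q < 1) (L : ℕ) (hL : 0 < L) (x : ℝ)
    (hx : ENNReal.ofReal (η ^ C) ≤ ν (Metric.ball x η)) :
    ENNReal.ofReal (η ^ (-(C / L))) ^ (q - 1) * ν (Metric.ball x η) ^ q ≤
      ∫⁻ y in Metric.ball x (L * η), ν (Metric.ball y η) ^ (q - 1) ∂ν := by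
  set K := ENNReal.ofReal (η ^ (-(C / L))) with hK
  have hLR : (0:ℝ) < L := by exact_mod_cast hL
  have hK0 : K ≠ 0 := by
    rw [hK]; simp [Real.rpow_pos_of_pos hη]
  have hKt : K ≠ ⊤ := ENNReal.ofReal_ne_top
  have hex : ∃ k : ℕ, 1 ≤ k ∧ k ≤ L ∧
      ν (Metric.ball x ((k + 1 : ℕ) * η)) ≤ K * ν (Metric.ball x (k * η)) := by
    by_contra! hcon
    have hind : ∀ k : ℕ, k ≤ L → 0 < k →
        K ^ k * ENNReal.ofReal (η ^ C) < ν (Metric.ball x ((k + 1 : ℕ) * η)) := by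
      intro k
      induction k with
      | zero => intro _ h; omega
      | succ k ih =>
        intro hkL _
        refine lt_of_le_of_lt ?_ (hcon (k + 1) (by omega) hkL)
        rw [pow_succ', mul_assoc]
        gcongr
        rcases Nat.eq_zero_or_pos k with h0 | h0
        · subst h0; simpa using hx
        · exact (ih (by omega) h0).le
    have h1 := (hind L le_rfl hL).trans_le prob_le_one
    rw [hK, ← ENNReal.ofReal_pow (by positivity), ← ENNReal.ofReal_mul (by positivity),
      ← Real.rpow_natCast, ← Real.rpow_mul hη.le, ← Real.rpow_add hη] at h1
    have : -(C / L) * L + C = 0 := by field_simp; ring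
    rw [this] at h1
    simp at h1
  obtain ⟨k, hk1, hkL, hk⟩ := hex
  have hkR : (1:ℝ) ≤ k := by exact_mod_cast hk1
  have hkLR : (k:ℝ) ≤ L := by exact_mod_cast hkL
  have hmono : ν (Metric.ball x η) ≤ ν (Metric.ball x (k * η)) :=
    measure_mono (Metric.ball_subset_ball (by nlinarith))
  set b := ν (Metric.ball x (k * η)) with hb
  have hb0 : b ≠ 0 := by
    have : 0 < ENNReal.ofReal (η ^ C) := by simp [Real.rpow_pos_of_pos hη]
    exact (this.trans_le (hx.trans hmono)).ne'
  have hbt : b ≠ ⊤ := measure_ne_top _ _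
  calc K ^ (q - 1) * ν (Metric.ball x η) ^ q
      ≤ K ^ (q - 1) * b ^ q := by gcongr
    _ = (K * b) ^ (q - 1) * b := by
        rw [ENNReal.mul_rpow_of_ne_top hKt hbt, mul_assoc]
        congr 1
        conv_rhs => rw [← ENNReal.rpow_one b, ← ENNReal.rpow_mul, one_mul,
          ← ENNReal.rpow_add _ _ hb0 hbt]
        congr 1; ring
    _ ≤ ν (Metric.ball x ((k + 1 : ℕ) * η)) ^ (q - 1) * b := by
        have hz : q - 1 ≤ 0 := by linarith
        exact mul_le_mul' (rpow_anti hz hk) le_rfl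
    _ = ∫⁻ y in Metric.ball x (k * η), ν (Metric.ball x ((k + 1 : ℕ) * η)) ^ (q - 1) ∂ν := by
        rw [setLIntegral_const]
    _ ≤ ∫⁻ y in Metric.ball x (k * η), ν (Metric.ball y η) ^ (q - 1) ∂ν := by
        apply setLIntegral_mono' Metric.isOpen_ball.measurableSet
        intro y hy
        apply rpow_anti (by linarith)
        apply measure_mono
        apply Metric.ball_subset_ball'
        rw [Metric.mem_ball] at hy
        push_cast
        linarith
    _ ≤ _ := lintegral_mono_set (Metric.ball_subset_ball
        (mul_le_mul_of_nonneg_right hkLR hη.le))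

/-- Comparison in the range `0 ≤ q < 1`. -/
lemma J_lt_one (ν ρ : Measure ℝ) [IsProbabilityMeasure ν] [IsProbabilityMeasure ρ]
    (P : ENNReal) (hP : P ≠ 0) (hPt : P ≠ ⊤) (hle : P • ρ ≤ ν) (C q η : ℝ) (hη : 0 < η)
    (hq0 : 0 ≤ q) (hq : q < 1) (L : ℕ) (hL : 0 < L)
    (hν : ∀ᵐ x ∂ν, ENNReal.ofReal (η ^ C) ≤ ν (Metric.ball x η))
    (hρ : ∀ᵐ x ∂ρ, ρ (Metric.ball x η) ≠ 0) :
    ENNReal.ofReal (η ^ (-(C / L))) ^ (q - 1) * (P ^ q * J ρ q η) ≤ (2 * L) * J ν q η := by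
  set K := ENNReal.ofReal (η ^ (-(C / L))) with hK
  have hν' : ∀ᵐ x ∂ρ, ENNReal.ofReal (η ^ C) ≤ ν (Metric.ball x η) := by
    rw [ae_iff] at hν ⊢
    have h1 := hle {a | ¬ENNReal.ofReal (η ^ C) ≤ ν (Metric.ball a η)}
    rw [hν, Measure.smul_apply, smul_eq_mul, nonpos_iff_eq_zero, mul_eq_zero] at h1
    exact h1.resolve_left hP
  have hmg := meas_ball ρ η
  have hmh := meas_ball ν η
  have hs : MeasurableSet {p : ℝ × ℝ | dist p.1 p.2 < L * η} :=
    measurableSet_lt measurable_dist measurable_const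
  let F : ℝ × ℝ → ENNReal := {p : ℝ × ℝ | dist p.1 p.2 < L * η}.indicator
    (fun z => (ρ (Metric.ball z.1 η))⁻¹ * ν (Metric.ball z.2 η) ^ (q - 1))
  have hF : Measurable F := by
    apply Measurable.indicator _ hs
    exact ((hmg.comp measurable_fst).inv).mul ((hmh.comp measurable_snd).pow_const _)
  have hF1 : ∀ x, ∫⁻ y, F (x, y) ∂ν = (ρ (Metric.ball x η))⁻¹ *
      ∫⁻ y in Metric.ball x (L * η), ν (Metric.ball y η) ^ (q - 1) ∂ν := by
    intro x
    rw [← lintegral_const_mul _ (hmh.pow_const _),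
      ← lintegral_indicator Metric.isOpen_ball.measurableSet]
    congr 1; ext y
    simp only [F, Set.indicator, Set.mem_ofPred_eq, Metric.mem_ball, dist_comm]
  have hF2 : ∀ y, ∫⁻ x, F (x, y) ∂ρ = ν (Metric.ball y η) ^ (q - 1) *
      ∫⁻ x in Metric.ball y (L * η), (ρ (Metric.ball x η))⁻¹ ∂ρ := by
    intro y
    rw [← lintegral_const_mul _ (f := fun x => (ρ (Metric.ball x η))⁻¹) hmg.inv,
      ← lintegral_indicator Metric.isOpen_ball.measurableSet]
    congr 1; ext x
    simp only [F, Set.indicator, Set.mem_ofPred_eq, Metric.mem_ball]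
    rw [mul_comm ((ρ (Metric.ball x η))⁻¹)]
  calc K ^ (q - 1) * (P ^ q * J ρ q η)
      = ∫⁻ x, K ^ (q - 1) * (P ^ q * ρ (Metric.ball x η) ^ (q - 1)) ∂ρ := by
        rw [lintegral_const_mul _ ((hmg.pow_const _).const_mul _),
          lintegral_const_mul _ (hmg.pow_const _), J]
    _ ≤ ∫⁻ x, (ρ (Metric.ball x η))⁻¹ *
      ∫⁻ y in Metric.ball x (L * η), ν (Metric.ball y η) ^ (q - 1) ∂ν ∂ρ := by
        apply lintegral_mono_ae
        filter_upwards [hν', hρ] with x h1 h2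
        refine le_trans ?_ (mul_le_mul_right (pigeon ν C q η hη hq0 hq L hL x h1) _)
        have h3 : P * ρ (Metric.ball x η) ≤ ν (Metric.ball x η) := by
          simpa using hle (Metric.ball x η)
        have h4 : ρ (Metric.ball x η) ^ (q - 1) =
            (ρ (Metric.ball x η))⁻¹ * ρ (Metric.ball x η) ^ q := by
          rw [← ENNReal.rpow_neg_one, ← ENNReal.rpow_add _ _ h2 (measure_ne_top _ _)]
          congr 1; ring
        calc K ^ (q - 1) * (P ^ q * ρ (Metric.ball x η) ^ (q - 1))
            = (ρ (Metric.ball x η))⁻¹ * (K ^ (q - 1) * (P * ρ (Metric.ball x η)) ^ q) := by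
              rw [h4, ENNReal.mul_rpow_of_nonneg _ _ hq0]; ring
          _ ≤ _ := by gcongr
    _ = ∫⁻ x, ∫⁻ y, F (x, y) ∂ν ∂ρ := by simp_rw [hF1]
    _ = ∫⁻ y, ∫⁻ x, F (x, y) ∂ρ ∂ν := lintegral_lintegral_swap (f := fun x y => F (x, y))
        hF.aemeasurable
    _ ≤ ∫⁻ y, ν (Metric.ball y η) ^ (q - 1) * (2 * L) ∂ν := by
        apply lintegral_mono
        intro y
        dsimp only
        rw [hF2]
        gcongr
        exact cover ρ η hη L y
    _ = (2 * L) * J ν q η := by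
        rw [lintegral_mul_const _ (hmh.pow_const _), mul_comm, J]
lemma tau_le_aux (g g' : ℝ → ℝ) (A e c T T' : ℝ) (hA : 0 < A)
    (hT : Tendsto (fun δ : ℝ => g δ / (-Real.log δ)) (nhdsWithin 0 (Set.Ioi 0)) (nhds T))
    (hT' : Tendsto (fun δ : ℝ => g' δ / (-Real.log δ)) (nhdsWithin 0 (Set.Ioi 0)) (nhds T'))
    (h : ∀ᶠ η in nhdsWithin (0:ℝ) (Set.Ioi 0), e * Real.log η + c + g' (η / A) ≤ g η) :
    T' - e ≤ T := by
  have hlog : Tendsto (fun η : ℝ => -Real.log η) (nhdsWithin 0 (Set.Ioi 0)) atTop :=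
    tendsto_neg_atBot_atTop.comp Real.tendsto_log_nhdsGT_zero
  have hsc : Tendsto (fun η : ℝ => η / A) (nhdsWithin 0 (Set.Ioi 0))
      (nhdsWithin 0 (Set.Ioi 0)) := by
    apply tendsto_nhdsWithin_iff.2
    constructor
    · have : Tendsto (fun η : ℝ => η / A) (nhds 0) (nhds (0 / A)) :=
        tendsto_id.div_const A
      rw [zero_div] at this
      exact this.mono_left nhdsWithin_le_nhds
    · filter_upwards [self_mem_nhdsWithin] with η hη
      exact div_pos hη hA
  have h1 := hT'.comp hsc
  have h2 : ∀ k : ℝ, Tendsto (fun η : ℝ => k / (-Real.log η)) (nhdsWithin 0 (Set.Ioi 0))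
      (nhds 0) := fun k => hlog.const_div_atTop k
  have h3 : Tendsto (fun η : ℝ => -e + c / (-Real.log η) +
      ((fun δ : ℝ => g' δ / (-Real.log δ)) ∘ (fun η : ℝ => η / A)) η *
        (1 + Real.log A / (-Real.log η)))
      (nhdsWithin 0 (Set.Ioi 0)) (nhds (-e + 0 + T' * (1 + 0))) :=
    ((h2 c).const_add (-e)).add (h1.mul ((h2 _).const_add 1))
  have h4 : -e + 0 + T' * (1 + 0) ≤ T := by
    apply le_of_tendsto_of_tendsto h3 hT
    have hev : ∀ᶠ δ in nhdsWithin (0:ℝ) (Set.Ioi 0), δ ∈ Set.Ioo (0:ℝ) (min 1 A) :=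
      Ioo_mem_nhdsGT (by positivity)
    filter_upwards [h, hev] with η h5 h6
    have hη1 : η < 1 := h6.2.trans_le (min_le_left _ _)
    have hηA : η < A := h6.2.trans_le (min_le_right _ _)
    have hl : Real.log η < 0 := Real.log_neg h6.1 hη1
    have hl2 : Real.log (η / A) < 0 :=
      Real.log_neg (div_pos h6.1 hA) ((div_lt_one hA).2 hηA)
    have hl3 : Real.log (η / A) = Real.log η - Real.log A := Real.log_div h6.1.ne' hA.ne'
    rw [le_div_iff₀ (by linarith)]
    refine le_trans (le_of_eq ?_) h5
    simp only [Function.comp]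
    have e1 : (1 + Real.log A / (-Real.log η)) = (-Real.log (η / A)) / (-Real.log η) := by
      rw [hl3]
      have := hl.ne
      field_simp
      ring
    rw [e1]
    have n1 := hl.ne
    have n2 := hl2.ne
    generalize Real.log (η / A) = u at n2
    generalize Real.log η = v at n1
    field_simp
    ring
  linarith

lemma tau_le (ν ν' : Measure ℝ) [IsProbabilityMeasure ν] [IsProbabilityMeasure ν']
    (C q P a t T T' : ℝ) (hC : MassBd ν C) (hC' : MassBd ν' C)
    (hP : 0 < P) (ha : a ≠ 0) (hq0 : 0 ≤ q)
    (hle : ENNReal.ofReal P • Measure.map (fun x => a * x + t) ν' ≤ ν)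
    (hT : IsLqSpec ν q T) (hT' : IsLqSpec ν' q T') : T' ≤ T := by
  have h1 := spec_tendsto ν C q T hC hT
  have h2 := spec_tendsto ν' C q T' hC' hT'
  have hm : Measurable fun x : ℝ => a * x + t := by fun_prop
  have hA : 0 < |a| := abs_pos.2 ha
  have hsc : Tendsto (fun η : ℝ => η / |a|) (nhdsWithin 0 (Set.Ioi 0))
      (nhdsWithin 0 (Set.Ioi 0)) := by
    apply tendsto_nhdsWithin_iff.2
    constructor
    · have : Tendsto (fun η : ℝ => η / |a|) (nhds 0) (nhds (0 / |a|)) :=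
        tendsto_id.div_const _
      rw [zero_div] at this
      exact this.mono_left nhdsWithin_le_nhds
    · filter_upwards [self_mem_nhdsWithin] with η hη
      exact div_pos hη hA
  have hC'' := hsc.eventually hC'
  have hpr : IsProbabilityMeasure (Measure.map (fun x => a * x + t) ν') :=
    Measure.isProbabilityMeasure_map hm.aemeasurable
  have hJ := fun δ => J_affine ν' a t q δ ha
  generalize Measure.map (fun x => a * x + t) ν' = ρ at hle hpr hJ
  have hP0 : ENNReal.ofReal P ≠ 0 := by simpa using hP
  have hPt : ENNReal.ofReal P ≠ ⊤ := ENNReal.ofReal_ne_top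
  have hPq : (ENNReal.ofReal P ^ q).toReal = P ^ q := by
    rw [← ENNReal.toReal_rpow, ENNReal.toReal_ofReal hP.le]
  rcases le_or_gt 1 q with hq | hq
  · have := tau_le_aux (fun δ => Real.log (J ν q δ).toReal) (fun δ => Real.log (J ν' q δ).toReal)
      |a| 0 (q * Real.log P) T T' hA h1 h2 ?_
    · linarith
    filter_upwards [hC, hC'', self_mem_nhdsWithin] with η h3 h4 h5
    have h6 := J_ge_one ν ρ _ hle q η hP0 hPt hq
    rw [hJ] at h6
    obtain ⟨b1, b2, -⟩ := J_bounds ν C q η h5 h3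
    obtain ⟨b3, b4, -⟩ := J_bounds ν' C q (η / |a|) (div_pos h5 hA) h4
    have h7 := ENNReal.toReal_mono b1 h6
    have p1 := ENNReal.toReal_pos b4 b3
    have p2 : 0 < P ^ q := Real.rpow_pos_of_pos hP q
    rw [ENNReal.toReal_mul, hPq] at h7
    have h8 := Real.log_le_log (by positivity) h7
    rw [Real.log_mul p2.ne' p1.ne', Real.log_rpow hP] at h8
    linarith
  · have key : ∀ L : ℕ, 0 < L → T' - C / L * (1 - q) ≤ T := by
      intro L hL
      refine tau_le_aux (fun δ => Real.log (J ν q δ).toReal)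
        (fun δ => Real.log (J ν' q δ).toReal)
        |a| _ (q * Real.log P - Real.log (2 * L)) T T' hA h1 h2 ?_
      filter_upwards [hC, hC'', self_mem_nhdsWithin] with η h3 h4 h5
      have h5' : 0 < η := h5
      have hρ : ∀ᵐ x ∂ρ, ρ (Metric.ball x η) ≠ 0 := by
        filter_upwards [ρ.support_mem_ae] with x hx
        exact ((Measure.mem_support_iff_forall x).1 hx _ (Metric.ball_mem_nhds x h5')).ne'
      have h6 := J_lt_one ν ρ _ hP0 hPt hle C q η h5' hq0 hq L hL h3 hρ
      rw [hJ] at h6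
      obtain ⟨b1, b2, -⟩ := J_bounds ν C q η h5 h3
      obtain ⟨b3, b4, -⟩ := J_bounds ν' C q (η / |a|) (div_pos h5' hA) h4
      have hLL : (2 * L : ENNReal) ≠ ⊤ := ENNReal.mul_ne_top (by simp) (by simp)
      have h7 := ENNReal.toReal_mono (ENNReal.mul_ne_top hLL b1) h6
      have p1 := ENNReal.toReal_pos b4 b3
      have p3 := ENNReal.toReal_pos b2 b1
      have p2 : 0 < P ^ q := Real.rpow_pos_of_pos hP q
      have p4 : 0 < η ^ (-(C / L)) := Real.rpow_pos_of_pos h5' _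
      have p5 : 0 < (η ^ (-(C / L))) ^ (q - 1) := Real.rpow_pos_of_pos p4 _
      have p6 : (0:ℝ) < 2 * L := by positivity
      rw [ENNReal.toReal_mul, ENNReal.toReal_mul, ENNReal.toReal_mul, ENNReal.toReal_mul, hPq,
        ← ENNReal.toReal_rpow, ENNReal.toReal_ofReal p4.le] at h7
      simp only [ENNReal.toReal_ofNat, ENNReal.toReal_natCast] at h7
      have h8 := Real.log_le_log (by positivity) h7
      rw [Real.log_mul p5.ne' (by positivity), Real.log_mul p2.ne' p1.ne', Real.log_rpow hP,
        Real.log_rpow p4, Real.log_rpow h5', Real.log_mul p6.ne' p3.ne'] at h8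
      linarith
    have hlim : Tendsto (fun L : ℕ => T' - C / L * (1 - q)) atTop (nhds (T' - 0 * (1 - q))) :=
      ((tendsto_const_div_atTop_nhds_zero_nat C).mul_const _).const_sub _
    have := le_of_tendsto hlim (by
      filter_upwards [eventually_gt_atTop 0] with L hL using key L hL)
    linarith

lemma S_meas (B : IFSData ι) (i : ι) : Measurable (B.S i) := by
  unfold IFSData.S
  cases B.swap i <;> cases B.sgn1 i <;> cases B.sgn2 i <;> simp <;> fun_prop

lemma S_lip (B : IFSData ι) (hc : ∀ i, 0 < B.c i) (hd : ∀ i, 0 < B.d i) (r : ℝ)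
    (hr : ∀ i, B.c i ≤ r ∧ B.d i ≤ r) (i : ι) (x y : ℝ × ℝ) :
    dist (B.S i x) (B.S i y) ≤ r * dist x y := by
  have key : ∀ (b : Bool) (c t u v : ℝ), 0 < c → c ≤ r → dist u v ≤ dist x y →
      dist ((if b then 1 else -1) * (c * u) + t) ((if b then 1 else -1) * (c * v) + t)
        ≤ r * dist x y := by
    intro b c t u v h1 h2 h3
    rw [dist_add_right]
    have : dist ((if b then (1:ℝ) else -1) * (c * u)) ((if b then 1 else -1) * (c * v))
        = c * dist u v := by
      rw [Real.dist_eq, Real.dist_eq, ← mul_sub, ← mul_sub, abs_mul, abs_mul, abs_of_pos h1]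
      cases b <;> simp
    rw [this]
    exact mul_le_mul h2 h3 dist_nonneg (h1.le.trans h2)
  have hx1 : dist x.1 y.1 ≤ dist x y := le_max_left _ _
  have hx2 : dist x.2 y.2 ≤ dist x y := le_max_right _ _
  rw [Prod.dist_eq (x := B.S i x)]
  unfold IFSData.S
  apply max_le
  · apply key _ _ _ _ _ (hc i) (hr i).1
    cases B.swap i <;> simpa
  · apply key _ _ _ _ _ (hd i) (hr i).2
    cases B.swap i <;> simpa

lemma tau_eq [Fintype ι] [Nonempty ι] (B : IFSData ι)
    (hc : ∀ i, B.c i ∈ Set.Ioo (0 : ℝ) 1) (hd : ∀ i, B.d i ∈ Set.Ioo (0 : ℝ) 1)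
    (p : ι → ℝ) (hp : ∀ i, p i ∈ Set.Ioo (0 : ℝ) 1)
    (μ : Measure (ℝ × ℝ)) [IsProbabilityMeasure μ]
    (hcpt : ∃ K : Set (ℝ × ℝ), IsCompact K ∧ μ Kᶜ = 0)
    (hself : μ = ∑ i : ι, ENNReal.ofReal (p i) • Measure.map (B.S i) μ)
    (q T1 T2 : ℝ) (hq : 0 ≤ q)
    (h1 : IsLqSpec (Measure.map Prod.fst μ) q T1)
    (h2 : IsLqSpec (Measure.map Prod.snd μ) q T2)
    (i : ι) (hi : B.swap i = true) : T1 = T2 := by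
  obtain ⟨i0, h0⟩ := Finite.exists_max (fun i => max (B.c i) (B.d i))
  obtain ⟨j0, h0'⟩ := Finite.exists_min p
  have hr0 : 0 < max (B.c i0) (B.d i0) := lt_max_of_lt_left (hc i0).1
  have hr1 : max (B.c i0) (B.d i0) < 1 := max_lt (hc i0).2 (hd i0).2
  have hr : ∀ i, B.c i ≤ max (B.c i0) (B.d i0) ∧ B.d i ≤ max (B.c i0) (B.d i0) := fun i =>
    ⟨(le_max_left _ _).trans (h0 i), (le_max_right _ _).trans (h0 i)⟩
  obtain ⟨D, hD, hmass⟩ := mass_geom B p μ hcpt hself (S_meas B) _ (p j0) (hp j0).1.le h0'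
    (S_lip B (fun i => (hc i).1) (fun i => (hd i).1) _ hr) hr0.le
  obtain ⟨C, -, hC⟩ := mass_ball μ _ _ D hr0 hr1 (hp j0).1 (hp j0).2 hD hmass
  have hC1 := mass_proj μ Prod.fst measurable_fst (fun x y => le_max_left _ _) C hC
  have hC2 := mass_proj μ Prod.snd measurable_snd (fun x y => le_max_right _ _) C hC
  have hle : ENNReal.ofReal (p i) • Measure.map (B.S i) μ ≤ μ := by
    conv_rhs => rw [hself]
    exact Finset.single_le_sum (f := fun i => ENNReal.ofReal (p i) • Measure.map (B.S i) μ)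
      (fun _ _ => Measure.zero_le _) (Finset.mem_univ i)
  have : IsProbabilityMeasure (Measure.map Prod.fst μ) :=
    Measure.isProbabilityMeasure_map measurable_fst.aemeasurable
  have : IsProbabilityMeasure (Measure.map Prod.snd μ) :=
    Measure.isProbabilityMeasure_map measurable_snd.aemeasurable
  have hsg : ∀ b : Bool, (if b then (1:ℝ) else -1) ≠ 0 := by intro b; cases b <;> simp
  apply le_antisymm
  · have hle2 := Measure.map_mono hle measurable_snd
    rw [Measure.map_smul, Measure.map_map measurable_snd (S_meas B i)] at hle2
    refine tau_le (Measure.map Prod.snd μ) (Measure.map Prod.fst μ) C q (p i)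
      ((if B.sgn2 i then 1 else -1) * B.d i) (B.t i).2 T2 T1 hC2 hC1 (hp i).1
      (mul_ne_zero (hsg _) (hd i).1.ne') hq ?_ h2 h1
    rw [Measure.map_map (by fun_prop) measurable_fst]
    convert hle2 using 3
    ext x
    simp [IFSData.S, hi]
  · have hle2 := Measure.map_mono hle measurable_fst
    rw [Measure.map_smul, Measure.map_map measurable_fst (S_meas B i)] at hle2
    refine tau_le (Measure.map Prod.fst μ) (Measure.map Prod.snd μ) C q (p i)
      ((if B.sgn1 i then 1 else -1) * B.c i) (B.t i).1 T1 T2 hC1 hC2 (hp i).1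
      (mul_ne_zero (hsg _) (hc i).1.ne') hq ?_ h1 h2
    rw [Measure.map_map (by fun_prop) measurable_snd]
    convert hle2 using 3
    ext x
    simp [IFSData.S, hi]

end SVAux

theorem multiplicative_properties_of_modified_singular_value_function
    {ι : Type} [Fintype ι] [Nonempty ι] (hcard : 2 ≤ Fintype.card ι)
    (B : IFSData ι)
    (hc : ∀ i, B.c i ∈ Set.Ioo (0 : ℝ) 1) (hd : ∀ i, B.d i ∈ Set.Ioo (0 : ℝ) 1)
    (p : ι → ℝ) (hp : ∀ i, p i ∈ Set.Ioo (0 : ℝ) 1) (hpsum : ∑ i : ι, p i = 1)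
    (μ : Measure (ℝ × ℝ)) [IsProbabilityMeasure μ]
    (hcpt : ∃ K : Set (ℝ × ℝ), IsCompact K ∧ μ Kᶜ = 0)
    (hself : μ = ∑ i : ι, ENNReal.ofReal (p i) • Measure.map (B.S i) μ)
    (τ1 τ2 : ℝ → ℝ)
    (hτ1 : ∀ q : ℝ, 0 ≤ q → IsLqSpec (Measure.map Prod.fst μ) q (τ1 q))
    (hτ2 : ∀ q : ℝ, 0 ≤ q → IsLqSpec (Measure.map Prod.snd μ) q (τ2 q))
     :
    ∀ q : ℝ, 0 ≤ q → ∀ s : ℝ,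
      (∀ i j : List ι, i ≠ [] → j ≠ [] →
        ((s < τ1 q + τ2 q →
            psiSV B p τ1 τ2 s q (i ++ j) ≤ psiSV B p τ1 τ2 s q i * psiSV B p τ1 τ2 s q j) ∧
         (s = τ1 q + τ2 q →
            psiSV B p τ1 τ2 s q (i ++ j) = psiSV B p τ1 τ2 s q i * psiSV B p τ1 τ2 s q j) ∧
         (τ1 q + τ2 q < s →
            psiSV B p τ1 τ2 s q i * psiSV B p τ1 τ2 s q j ≤ psiSV B p τ1 τ2 s q (i ++ j)))) ∧
      (∀ k l : ℕ, 1 ≤ k → 1 ≤ l →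
        ((s < τ1 q + τ2 q →
            PsiSV B p τ1 τ2 (k + l) s q ≤ PsiSV B p τ1 τ2 k s q * PsiSV B p τ1 τ2 l s q) ∧
         (s = τ1 q + τ2 q →
            PsiSV B p τ1 τ2 (k + l) s q = PsiSV B p τ1 τ2 k s q * PsiSV B p τ1 τ2 l s q) ∧
         (τ1 q + τ2 q < s →
            PsiSV B p τ1 τ2 k s q * PsiSV B p τ1 τ2 l s q ≤ PsiSV B p τ1 τ2 (k + l) s q))) := by
  intro q hq s
  have hc0 : ∀ i, 0 < B.c i := fun i => (hc i).1
  have hd0 : ∀ i, 0 < B.d i := fun i => (hd i).1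
  have hp0 : ∀ i, 0 < p i := fun i => (hp i).1
  have h : (∀ i, B.swap i = false) ∨ τ1 q = τ2 q := by
    by_cases hs : ∀ i, B.swap i = false
    · exact Or.inl hs
    · push Not at hs
      obtain ⟨i, hi⟩ := hs
      exact Or.inr (SVAux.tau_eq B hc hd p hp μ hcpt hself q _ _ hq (hτ1 q hq) (hτ2 q hq) i
        (by simpa using hi))
  have hm := SVAux.psi_mult B hc0 hd0 p hp0 τ1 τ2 q s h
  refine ⟨fun i j _ _ => hm i j, fun k l _ _ => ?_⟩
  rw [SVAux.Psi_add, SVAux.Psi_mul]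
  refine ⟨fun hs => ?_, fun hs => ?_, fun hs => ?_⟩
  · exact Finset.sum_le_sum fun x _ => (hm _ _).1 hs
  · exact Finset.sum_congr rfl fun x _ => (hm _ _).2.1 hs
  · exact Finset.sum_le_sum fun x _ => (hm _ _).2.2 hs
end
end
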